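/- arXiv:2010.06031 — 3 statements merged into one kernel-verified Lean document; each statement's English description precedes it below -/
import Mathlib

section
/- Let (G,S) be an essential set-equipped graph whose graph G contains at least one cycle, and let X = X(G,S). If λ is the radius of convergence of the power series Σ_{w ∈ W(G)} H_w(x), where the sum ranges over all walks on G and H_w(x) is the product of the generating functions H_i(x) over the vertices i of the walk w (with multiplicity), then the topological entropy of X equals log(1/λ). -/
open Filter Topology

/-- The shift map on bi-infinite sequences over the alphabet `A`. -/
def shiftMap {A : Type*} (x : ℤ → A) : ℤ → A := fun i => x (i + 1)

/-- A finite word `w` appears (as a consecutive subsequence) in the bi-infinite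
sequence `x`. -/
def Appears {A : Type*} (w : List A) (x : ℤ → A) : Prop :=
  ∃ k : ℤ, ∀ i : Fin w.length, x (k + (i : ℕ)) = w.get i

/-- `w` belongs to the language of `X`: it appears in some point of `X`. -/
def InLanguage {A : Type*} (X : Set (ℤ → A)) (w : List A) : Prop :=
  ∃ x ∈ X, Appears w x

/-- `X` has topological entropy `h`, i.e. `(1/n) · log |B_n(X)| → h`. -/
def HasEntropy {A : Type*} (X : Set (ℤ → A)) (h : ℝ) : Prop :=
  Filter.Tendsto
    (fun n : ℕ => Real.log ({w : List A | w.length = n ∧ InLanguage X w}.ncard) / n)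
    Filter.atTop (nhds h)

/-- The set of bi-infinite concatenations `⋯ u₋₁^{n₋₁} u₀^{n₀} u₁^{n₁} ⋯` with
`uᵢ ∈ V`, `nᵢ ∈ S uᵢ` and `(uᵢ, uᵢ₊₁)` an edge of the graph.  The `S`-graph shift
`X(G,S)` is the closure of this set. -/
def SGraphCore {V : Type*} (Adj : V → V → Prop) (S : V → Set ℕ) : Set (ℤ → V) :=
  {x | ∃ (a : ℤ → V) (t : ℤ → ℤ), StrictMono t ∧
    (∀ i : ℤ, (t (i + 1) - t i).toNat ∈ S (a i)) ∧
    (∀ i : ℤ, Adj (a i) (a (i + 1))) ∧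
    (∀ i k : ℤ, t i ≤ k → k < t (i + 1) → x k = a i) ∧
    (∀ m : ℤ, ∃ i : ℤ, t i ≤ m ∧ m < t (i + 1))}

/-- The list of vertices `l` is a cycle of the graph. -/
def IsCycleList {V : Type*} (Adj : V → V → Prop) (l : List V) : Prop :=
  l ≠ [] ∧ l.Nodup ∧ l.Chain' Adj ∧ ∀ h : l ≠ [], Adj (l.getLast h) (l.head h)

/-- The coefficient of `xⁿ` in `∑_{w ∈ W(G)} H_w(x)`: the number of walks `w` on
`G` decorated with a selection `s_i ∈ S_{v_i}` at every vertex (with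
multiplicity), whose selections sum to `n`.  Such a decorated walk is encoded as
a nonempty list of pairs (vertex, selection). -/
noncomputable def walkCoeff {V : Type*} (Adj : V → V → Prop) (S : V → Set ℕ)
    (n : ℕ) : ℕ :=
  {l : List (V × ℕ) | l ≠ [] ∧ List.Chain' (fun p q => Adj p.1 q.1) l ∧
    (∀ p ∈ l, p.2 ∈ S p.1) ∧ (l.map Prod.snd).sum = n}.ncard

/-! ### Growth rates and radii of convergence -/

theorem exp_neg_le_of_growth {b c : ℕ → ℕ} {h lam : ℝ}
    (hb : ∀ n, 1 ≤ b n) (hlim : Tendsto (fun n => Real.log (b n) / n) atTop (𝓝 h))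
    (hcb : ∀ n, c n ≤ b n) (hlam : 0 ≤ lam)
    (hdiv : ∀ x : ℝ, lam < x → ¬ Summable (fun n : ℕ => (c n : ℝ) * x ^ n)) :
    Real.exp (-h) ≤ lam := by
  by_contra! hlt
  obtain ⟨x, hx1, hx2⟩ := exists_between hlt
  have hx0 : 0 < x := hlam.trans_lt hx1
  refine hdiv x hx1 ?_
  have hlog : h < -Real.log x := by
    have := (Real.log_lt_iff_lt_exp hx0).2 hx2
    linarith
  obtain ⟨r, hr1, hr2⟩ := exists_between hlog
  have hq : Real.exp r * x < 1 := by
    have : Real.exp r * x = Real.exp (r + Real.log x) := by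
      rw [Real.exp_add, Real.exp_log hx0]
    rw [this, Real.exp_lt_one_iff]
    linarith
  refine Summable.of_norm_bounded_eventually_nat
    (summable_geometric_of_lt_one (by positivity) hq) ?_
  filter_upwards [hlim.eventually_lt_const hr1, eventually_gt_atTop 0] with n hn hn0
  have hn0' : (0 : ℝ) < n := by exact_mod_cast hn0
  have hbn : (0 : ℝ) < b n := by exact_mod_cast hb n
  have h1 : (b n : ℝ) ≤ Real.exp r ^ n := by
    rw [← Real.exp_nat_mul, ← Real.log_le_iff_le_exp hbn]
    rw [div_lt_iff₀ hn0'] at hn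
    linarith
  have h2 : (c n : ℝ) ≤ b n := by exact_mod_cast hcb n
  rw [Real.norm_of_nonneg (by positivity), mul_pow]
  gcongr
  exact h2.trans h1

theorem le_one_of_frequently_ne_zero {c : ℕ → ℕ} {lam : ℝ} (hinf : ∃ᶠ n in atTop, c n ≠ 0)
    (hconv : ∀ x : ℝ, 0 ≤ x → x < lam → Summable (fun n : ℕ => (c n : ℝ) * x ^ n)) :
    lam ≤ 1 := by
  by_contra! hlt
  have hs := (hconv 1 zero_le_one hlt).tendsto_atTop_zero
  simp only [one_pow, mul_one] at hs
  refine hinf ?_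
  filter_upwards [hs.eventually_lt_const one_pos] with n hn
  have : c n < 1 := by exact_mod_cast hn
  omega

theorem le_exp_neg_of_growth {b c : ℕ → ℕ} {h lam K : ℝ} {d : ℕ}
    (hb : ∀ n, 1 ≤ b n) (hlim : Tendsto (fun n => Real.log (b n) / n) atTop (𝓝 h))
    (hK : 0 ≤ K)
    (hbc : ∀ n, ∀ M : ℝ, (∀ m ≤ n, (c m : ℝ) ≤ M) → (b n : ℝ) ≤ K * (n + 1) ^ d * (M + 1))
    (hinf : ∃ᶠ n in atTop, c n ≠ 0)
    (hconv : ∀ x : ℝ, 0 ≤ x → x < lam → Summable (fun n : ℕ => (c n : ℝ) * x ^ n)) :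
    lam ≤ Real.exp (-h) := by
  by_contra! hlt
  obtain ⟨x, hx1, hx2⟩ := exists_between hlt
  have hx0 : 0 < x := (Real.exp_pos _).trans hx1
  have hxle : x ≤ 1 := hx2.le.trans (le_one_of_frequently_ne_zero hinf hconv)
  have hs := hconv x hx0.le hx2
  set C := ∑' n : ℕ, (c n : ℝ) * x ^ n
  have hC0 : 0 ≤ C := tsum_nonneg fun n => by positivity
  have hC : ∀ n, (c n : ℝ) * x ^ n ≤ C := fun n => hs.le_tsum n fun j _ => by positivity
  have hlog : -Real.log x < h := by
    have := (Real.lt_log_iff_exp_lt hx0).2 hx1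
    linarith
  obtain ⟨r, hr1, hr2⟩ := exists_between hlog
  set q := Real.exp (-r) * x⁻¹ with hqdef
  have hq0 : 0 < q := by positivity
  have hq : q < 1 := by
    have : q = Real.exp (-r - Real.log x) := by
      rw [sub_eq_add_neg, Real.exp_add, Real.exp_neg (Real.log x), Real.exp_log hx0]
    rw [this, Real.exp_lt_one_iff]
    linarith
  have hbound : ∀ n, (b n : ℝ) ≤ K * (n + 1) ^ d * ((C + 1) * x⁻¹ ^ n) := by
    intro n
    have hxn : 1 ≤ x⁻¹ ^ n := one_le_pow₀ ((one_le_inv₀ hx0).2 hxle)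
    refine (hbc n (C * x⁻¹ ^ n) fun m hm => ?_).trans ?_
    · calc (c m : ℝ) = (c m * x ^ m) * x⁻¹ ^ m := by
            rw [mul_assoc, ← mul_pow, mul_inv_cancel₀ hx0.ne', one_pow, mul_one]
        _ ≤ C * x⁻¹ ^ n := by
            gcongr
            · exact hC m
            · exact (one_le_inv₀ hx0).2 hxle
    · gcongr
      linarith
  have htend : Tendsto (fun n : ℕ => K * (C + 1) * q⁻¹ * (((n + 1 : ℕ) : ℝ) ^ d * q ^ (n + 1)))
      atTop (𝓝 0) := by
    have := (tendsto_pow_const_mul_const_pow_of_abs_lt_one d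
      (by rwa [abs_of_pos hq0] : |q| < 1)).comp (tendsto_add_atTop_nat 1)
    simpa using this.const_mul (K * (C + 1) * q⁻¹)
  obtain ⟨n, hn1, hn2, hn0⟩ := ((htend.eventually_lt_const one_pos).and
    ((hlim.eventually_const_lt hr2).and (eventually_gt_atTop 0))).exists
  have hn0' : (0 : ℝ) < n := by exact_mod_cast hn0
  have hbn : (0 : ℝ) < b n := by exact_mod_cast hb n
  have h1 : Real.exp r ^ n ≤ b n := by
    rw [← Real.exp_nat_mul, ← Real.le_log_iff_exp_le hbn]
    rw [lt_div_iff₀ hn0'] at hn2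
    linarith
  have h2 : K * (C + 1) * q⁻¹ * (((n + 1 : ℕ) : ℝ) ^ d * q ^ (n + 1)) =
      Real.exp (-r) ^ n * (K * (n + 1) ^ d * ((C + 1) * x⁻¹ ^ n)) := by
    have : q⁻¹ * q ^ (n + 1) = Real.exp (-r) ^ n * x⁻¹ ^ n := by
      rw [pow_succ', inv_mul_cancel_left₀ hq0.ne', hqdef, mul_pow]
    push_cast
    linear_combination K * (C + 1) * (n + 1) ^ d * this
  have h3 : Real.exp (-r) ^ n * Real.exp r ^ n = 1 := by
    rw [← mul_pow, ← Real.exp_add]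
    simp
  have h4 : Real.exp (-r) ^ n * Real.exp r ^ n ≤
      Real.exp (-r) ^ n * (K * (n + 1) ^ d * ((C + 1) * x⁻¹ ^ n)) := by
    gcongr
    exact h1.trans (hbound n)
  linarith

/-! ### Windows of bi-infinite sequences -/

section Window

variable {A : Type*}

/-- The word of length `n` read off `x` from position `k` on. -/
def window (x : ℤ → A) (k : ℤ) (n : ℕ) : List A :=
  (List.range n).map fun i : ℕ => x (k + i)

@[simp]
theorem length_window (x : ℤ → A) (k : ℤ) (n : ℕ) : (window x k n).length = n := by
  simp [window]

theorem window_add (x : ℤ → A) (k : ℤ) (m n : ℕ) :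
    window x k (m + n) = window x k m ++ window x (k + m) n := by
  simp [window, List.range_add, add_assoc]

theorem window_eq_replicate {x : ℤ → A} {k : ℤ} {n : ℕ} {v : A}
    (h : ∀ j : ℤ, k ≤ j → j < k + n → x j = v) : window x k n = List.replicate n v := by
  rw [List.eq_replicate_iff]
  refine ⟨length_window x k n, fun b hb => ?_⟩
  simp only [window, List.mem_map, List.mem_range] at hb
  obtain ⟨i, hi, rfl⟩ := hb
  exact h _ (by omega) (by omega)

theorem appears_iff_window {w : List A} {x : ℤ → A} :
    Appears w x ↔ ∃ k, window x k w.length = w := by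
  refine exists_congr fun k => ⟨fun h => ?_, fun h i => ?_⟩
  · refine List.ext_getElem (by simp) fun i h1 h2 => ?_
    simpa [window] using h ⟨i, h2⟩
  · have : (window x k w.length)[(i : ℕ)]'(by simp) = w[(i : ℕ)] := by simp only [h]
    simpa [window] using this

theorem appears_window (x : ℤ → A) (k : ℤ) (n : ℕ) : Appears (window x k n) x :=
  appears_iff_window.2 ⟨k, by rw [length_window]⟩

theorem inLanguage_closure_iff [TopologicalSpace A] [DiscreteTopology A] {X : Set (ℤ → A)}
    {w : List A} : InLanguage (closure X) w ↔ InLanguage X w := by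
  refine ⟨?_, fun ⟨x, hx, h⟩ => ⟨x, subset_closure hx, h⟩⟩
  rintro ⟨x, hx, k, hk⟩
  have hopen : IsOpen {y : ℤ → A | ∀ i : Fin w.length, y (k + (i : ℕ)) = w.get i} := by
    rw [Set.ofPred_forall]
    refine isOpen_iInter_of_finite fun i => ?_
    have hc : Continuous fun y : ℤ → A => y (k + (i : ℕ)) := continuous_apply _
    exact (isOpen_discrete {w.get i}).preimage hc
  obtain ⟨y, hy, hyX⟩ := mem_closure_iff.1 hx _ hopen hk
  exact ⟨y, hyX, k, hy⟩

/-- The number of words of length `n` in the language of `X`. -/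
noncomputable def wordCount (X : Set (ℤ → A)) (n : ℕ) : ℕ :=
  {w : List A | w.length = n ∧ InLanguage X w}.ncard

theorem finite_words [Finite A] (X : Set (ℤ → A)) (n : ℕ) :
    {w : List A | w.length = n ∧ InLanguage X w}.Finite :=
  (List.finite_length_eq A n).subset fun _ h => h.1

theorem one_le_wordCount [Finite A] {X : Set (ℤ → A)} (hX : X.Nonempty) (n : ℕ) :
    1 ≤ wordCount X n := by
  obtain ⟨x, hx⟩ := hX
  exact (Set.ncard_pos (finite_words X n)).2
    ⟨window x 0 n, length_window _ _ _, x, hx, appears_window _ _ _⟩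

theorem wordCount_add_le [Finite A] (X : Set (ℤ → A)) (m n : ℕ) :
    wordCount X (m + n) ≤ wordCount X m * wordCount X n := by
  unfold wordCount
  rw [← Set.ncard_prod]
  refine Set.ncard_le_ncard_of_injOn (fun w => (w.take m, w.drop m)) ?_ ?_
    ((finite_words X m).prod (finite_words X n))
  · rintro w ⟨hw, x, hx, hwx⟩
    obtain ⟨k, hk⟩ := appears_iff_window.1 hwx
    rw [hw, window_add] at hk
    have h1 : w.take m = window x k m := by
      rw [← hk, List.take_left' (length_window _ _ _)]
    have h2 : w.drop m = window x (k + m) n := by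
      rw [← hk, List.drop_left' (length_window _ _ _)]
    simp only [h1, h2]
    exact ⟨⟨length_window _ _ _, x, hx, appears_window _ _ _⟩,
      ⟨length_window _ _ _, x, hx, appears_window _ _ _⟩⟩
  · intro w _ w' _ h
    simp only [Prod.mk.injEq] at h
    rw [← List.take_append_drop m w, ← List.take_append_drop m w', h.1, h.2]

theorem exists_tendsto_log_wordCount [Finite A] {X : Set (ℤ → A)} (hX : X.Nonempty) :
    ∃ h, Tendsto (fun n => Real.log (wordCount X n) / n) atTop (𝓝 h) := by
  have hpos : ∀ n, (0 : ℝ) < wordCount X n := fun n => by exact_mod_cast one_le_wordCount hX n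
  have hsub : Subadditive fun n => Real.log (wordCount X n) := fun m n => by
    rw [← Real.log_mul (hpos m).ne' (hpos n).ne']
    exact Real.log_le_log (hpos _) (by exact_mod_cast wordCount_add_le X m n)
  refine ⟨_, hsub.tendsto_lim ⟨0, ?_⟩⟩
  rintro _ ⟨n, rfl⟩
  have : 0 ≤ Real.log (wordCount X n) := Real.log_natCast_nonneg _
  positivity

end Window

/-! ### Decorated walks -/

section Walks

variable {V : Type*} {Adj : V → V → Prop} {S : V → Set ℕ}

/-- The word spelled by a list of runs. -/
def spell (l : List (V × ℕ)) : List V :=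
  l.flatMap fun p => List.replicate p.2 p.1

@[simp]
theorem spell_nil : spell ([] : List (V × ℕ)) = [] := rfl

@[simp]
theorem spell_cons (p : V × ℕ) (l : List (V × ℕ)) :
    spell (p :: l) = List.replicate p.2 p.1 ++ spell l := rfl

theorem length_spell (l : List (V × ℕ)) : (spell l).length = (l.map Prod.snd).sum := by
  induction l with
  | nil => rfl
  | cons p l ih => simp [ih]

/-- Walks decorated with a selection at every vertex, the selections having sum `n`; the
empty walk is allowed. -/
def decoratedWalks (Adj : V → V → Prop) (S : V → Set ℕ) (n : ℕ) : Set (List (V × ℕ)) :=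
  {l | List.IsChain (fun p q => Adj p.1 q.1) l ∧ (∀ p ∈ l, p.2 ∈ S p.1) ∧
    (l.map Prod.snd).sum = n}

theorem spell_ne_cons (hLoop : ∀ v, ¬ Adj v v) (hPos : ∀ v, 0 ∉ S v) {p : V × ℕ}
    {l : List (V × ℕ)} (hl : List.IsChain (fun p q => Adj p.1 q.1) (p :: l))
    (hS : ∀ q ∈ l, q.2 ∈ S q.1) (w : List V) : spell l ≠ p.1 :: w := by
  cases l with
  | nil => simp
  | cons q l =>
    obtain ⟨v, s⟩ := q
    have hadj : Adj p.1 v := (List.isChain_cons_cons.1 hl).1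
    have hs : s ∈ S v := hS (v, s) (by simp)
    cases s with
    | zero => exact absurd hs (hPos v)
    | succ s =>
      intro h
      simp only [spell_cons, List.replicate_succ, List.cons_append, List.cons.injEq] at h
      exact hLoop v (by simpa [h.1] using hadj)

theorem spell_injective (hLoop : ∀ v, ¬ Adj v v) (hPos : ∀ v, 0 ∉ S v)
    {l m : List (V × ℕ)}
    (hl : List.IsChain (fun p q => Adj p.1 q.1) l) (hlS : ∀ p ∈ l, p.2 ∈ S p.1)
    (hm : List.IsChain (fun p q => Adj p.1 q.1) m) (hmS : ∀ p ∈ m, p.2 ∈ S p.1)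
    (h : spell l = spell m) : l = m := by
  have hpos : ∀ p : V × ℕ, p.2 ∈ S p.1 → 0 < p.2 := fun p hp =>
    Nat.pos_of_ne_zero fun h0 => hPos p.1 (h0 ▸ hp)
  have hcons : ∀ (p : V × ℕ) (l : List (V × ℕ)), p.2 ∈ S p.1 →
      spell (p :: l) = p.1 :: (List.replicate (p.2 - 1) p.1 ++ spell l) := by
    intro p l hp
    obtain ⟨s, hs⟩ := Nat.exists_eq_succ_of_ne_zero (hpos p hp).ne'
    simp [hs, List.replicate_succ]
  have hlt : ∀ (v : V) (s t : ℕ) (l m : List (V × ℕ)),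
      List.IsChain (fun p q => Adj p.1 q.1) ((v, s) :: l) → (∀ q ∈ l, q.2 ∈ S q.1) →
      spell ((v, s) :: l) = spell ((v, t) :: m) → ¬ s < t := by
    intro v s t l m hc hS h hst
    obtain ⟨k, rfl⟩ := Nat.exists_eq_add_of_lt hst
    simp only [spell_cons, add_assoc, List.replicate_add, List.append_assoc,
      List.append_cancel_left_eq] at h
    refine spell_ne_cons hLoop hPos hc hS (List.replicate k v ++ spell m) ?_
    rw [h, ← List.append_assoc, ← List.replicate_add, add_comm k, List.replicate_add]
    simp
  induction l generalizing m with
  | nil =>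
    cases m with
    | nil => rfl
    | cons q m => rw [hcons q m (hmS q (by simp))] at h; simp at h
  | cons p l ih =>
    cases m with
    | nil => rw [hcons p l (hlS p (by simp))] at h; simp at h
    | cons q m =>
      have hhead : p.1 = q.1 := by
        have := h
        rw [hcons p l (hlS p (by simp)), hcons q m (hmS q (by simp))] at this
        exact (List.cons.inj this).1
      obtain ⟨v, s⟩ := p
      obtain ⟨u, t⟩ := q
      obtain rfl : v = u := hhead
      have hlS' : ∀ q ∈ l, q.2 ∈ S q.1 := fun q hq => hlS q (by simp [hq])
      have hmS' : ∀ q ∈ m, q.2 ∈ S q.1 := fun q hq => hmS q (by simp [hq])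
      have h1 := hlt v s t l m hl hlS' h
      have h2 := hlt v t s m l hm hmS' h.symm
      obtain rfl : s = t := by omega
      simp only [spell_cons, List.append_cancel_left_eq] at h
      exact congrArg _ (ih hl.tail hlS' hm.tail hmS' h)

theorem injOn_spell (hLoop : ∀ v, ¬ Adj v v) (hPos : ∀ v, 0 ∉ S v) (n : ℕ) :
    Set.InjOn spell (decoratedWalks Adj S n) := fun _ hl _ hm h =>
  spell_injective hLoop hPos hl.1 hl.2.1 hm.1 hm.2.1 h

theorem finite_decoratedWalks [Finite V] (hLoop : ∀ v, ¬ Adj v v) (hPos : ∀ v, 0 ∉ S v)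
    (n : ℕ) : (decoratedWalks Adj S n).Finite := by
  refine Set.Finite.of_finite_image ((List.finite_length_eq V n).subset ?_)
    (injOn_spell hLoop hPos n)
  rintro _ ⟨l, hl, rfl⟩
  exact (length_spell l).trans hl.2.2

theorem walkCoeff_eq (n : ℕ) :
    walkCoeff Adj S n = {l | l ≠ [] ∧ l ∈ decoratedWalks Adj S n}.ncard := rfl

theorem ncard_decoratedWalks_le [Finite V] (hLoop : ∀ v, ¬ Adj v v) (hPos : ∀ v, 0 ∉ S v)
    (n : ℕ) : (decoratedWalks Adj S n).ncard ≤ walkCoeff Adj S n + 1 := by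
  rw [walkCoeff_eq]
  refine le_trans (Set.ncard_le_ncard ?_ ?_) (Set.ncard_insert_le [] _)
  · intro l hl
    by_cases h : l = []
    · exact Or.inl h
    · exact Or.inr ⟨h, hl⟩
  · exact ((finite_decoratedWalks hLoop hPos n).subset fun l hl => hl.2).insert _

/-- The runs numbered `i, …, i + j - 1` of a bi-infinite concatenation. -/
def runs (a : ℤ → V) (t : ℤ → ℤ) (i : ℤ) (j : ℕ) : List (V × ℕ) :=
  (List.range j).map fun r : ℕ => (a (i + r), (t (i + r + 1) - t (i + r)).toNat)

theorem runs_succ (a : ℤ → V) (t : ℤ → ℤ) (i : ℤ) (j : ℕ) :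
    runs a t i (j + 1) = runs a t i j ++ [(a (i + j), (t (i + j + 1) - t (i + j)).toNat)] := by
  simp [runs, List.range_succ]

theorem sum_runs {t : ℤ → ℤ} (ht : StrictMono t) (a : ℤ → V) (i : ℤ) (j : ℕ) :
    (((runs a t i j).map Prod.snd).sum : ℤ) = t (i + j) - t i := by
  induction j with
  | zero => simp [runs]
  | succ j ih =>
    have := ht (lt_add_one (i + j))
    rw [runs_succ, List.map_append, List.sum_append, Nat.cast_add, ih, Nat.cast_succ,
      ← add_assoc]
    simp only [List.map_cons, List.map_nil, List.sum_cons, List.sum_nil]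
    omega

theorem window_eq_spell_runs {x : ℤ → V} {a : ℤ → V} {t : ℤ → ℤ} (ht : StrictMono t)
    (hx : ∀ i k : ℤ, t i ≤ k → k < t (i + 1) → x k = a i) (i : ℤ) (j : ℕ) :
    window x (t i) ((runs a t i j).map Prod.snd).sum = spell (runs a t i j) := by
  induction j with
  | zero => simp [runs, window]
  | succ j ih =>
    have hsum := sum_runs ht a i j
    have hlt := ht (lt_add_one (i + j))
    rw [runs_succ, List.map_append, List.sum_append, window_add, ih, hsum]
    simp only [List.map_cons, List.map_nil, List.sum_cons, List.sum_nil, add_zero, spell,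
      List.flatMap_append, List.flatMap_cons, List.flatMap_nil, List.append_nil]
    rw [window_eq_replicate (v := a (i + j))]
    intro k h1 h2
    exact hx _ _ (by omega) (by omega)

theorem runs_mem_decoratedWalks {a : ℤ → V} {t : ℤ → ℤ}
    (hS : ∀ i : ℤ, (t (i + 1) - t i).toNat ∈ S (a i))
    (hadj : ∀ i : ℤ, Adj (a i) (a (i + 1))) (i : ℤ) (j : ℕ) :
    runs a t i j ∈ decoratedWalks Adj S ((runs a t i j).map Prod.snd).sum := by
  refine ⟨?_, ?_, rfl⟩
  · rw [runs, List.isChain_map, List.isChain_range]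
    intro m _
    have := hadj (i + m)
    push_cast
    rwa [← add_assoc]
  · intro p hp
    simp only [runs, List.mem_map] at hp
    obtain ⟨r, -, rfl⟩ := hp
    exact hS _

/-! ### Points of the shift -/

theorem exists_step_function (f : ℤ → ℕ) (hf : ∀ i, 0 < f i) :
    ∃ t : ℤ → ℤ, t 0 = 0 ∧ StrictMono t ∧ ∀ i, t (i + 1) - t i = f i := by
  let t : ℤ → ℤ := fun i => ∑ j ∈ Finset.Ico 0 i, (f j : ℤ) - ∑ j ∈ Finset.Ico i 0, (f j : ℤ)
  have ht : ∀ i, t (i + 1) - t i = f i := by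
    intro i
    rcases le_or_gt 0 i with hi | hi
    · have h1 : Finset.Ico 0 (i + 1) = insert i (Finset.Ico 0 i) := by
        ext; simp; omega
      simp only [t, h1, Finset.Ico_eq_empty_of_le hi,
        Finset.Ico_eq_empty_of_le (hi.trans (lt_add_one i).le)]
      simp
    · have h1 : Finset.Ico i 0 = insert i (Finset.Ico (i + 1) 0) := by
        ext; simp; omega
      have h2 : i + 1 ≤ 0 := hi
      simp [t, h1, Finset.Ico_eq_empty_of_le, hi.le, h2]
  refine ⟨t, by simp [t], strictMono_int_of_lt_succ fun i => ?_, ht⟩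
  have h1 := ht i
  have h2 := hf i
  omega

theorem exists_mem_step {t : ℤ → ℤ} (ht : StrictMono t) (h0 : t 0 = 0) (m : ℤ) :
    ∃ i : ℤ, t i ≤ m ∧ m < t (i + 1) := by
  have hup : ∀ i : ℕ, (i : ℤ) ≤ t i := fun i => by
    induction i with
    | zero => simp [h0]
    | succ i ih =>
      have := ht (lt_add_one (i : ℤ))
      push_cast
      omega
  have hdown : ∀ i : ℕ, t (-i) ≤ -i := fun i => by
    induction i with
    | zero => simp [h0]
    | succ i ih =>
      have := ht (show -((i + 1 : ℕ) : ℤ) < -(i : ℤ) by omega)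
      push_cast at this ⊢
      omega
  obtain ⟨i, hi, hmax⟩ := Int.exists_greatest_of_bdd (P := fun i => t i ≤ m)
    ⟨m.toNat, fun z hz => by
      by_contra! hlt
      have h1 := hup m.toNat
      have h2 := ht hlt
      omega⟩
    ⟨-(m.natAbs : ℤ), (hdown m.natAbs).trans (by omega)⟩
  refine ⟨i, hi, ?_⟩
  by_contra! hle
  have := hmax _ hle
  omega

theorem exists_core_point (hPos : ∀ v, 0 ∉ S v) (f : ℤ → V × ℕ)
    (hS : ∀ i, (f i).2 ∈ S (f i).1) (hadj : ∀ i, Adj (f i).1 (f (i + 1)).1) :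
    ∃ x : ℤ → V, ∃ t : ℤ → ℤ, StrictMono t ∧ (∀ i, t (i + 1) - t i = (f i).2) ∧
      (∀ i k : ℤ, t i ≤ k → k < t (i + 1) → x k = (f i).1) ∧ x ∈ SGraphCore Adj S := by
  obtain ⟨t, h0, ht, hstep⟩ := exists_step_function (fun i => (f i).2) fun i =>
    Nat.pos_of_ne_zero fun h => hPos (f i).1 (h ▸ hS i)
  choose g hg1 hg2 using exists_mem_step ht h0
  have hx : ∀ i k : ℤ, t i ≤ k → k < t (i + 1) → (f (g k)).1 = (f i).1 := by
    intro i k h1 h2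
    have h3 := ht.lt_iff_lt.1 (h1.trans_lt (hg2 k))
    have h4 := ht.lt_iff_lt.1 ((hg1 k).trans_lt h2)
    obtain rfl : g k = i := by omega
    rfl
  exact ⟨fun k => (f (g k)).1, t, ht, hstep, hx, fun i => (f i).1, t, ht,
    fun i => by simpa [hstep] using hS i, hadj, hx, exists_mem_step ht h0⟩

theorem exists_biinfinite_extension (hNe : ∀ v, (S v).Nonempty)
    (hEss : ∀ v : V, (∃ u, Adj u v) ∧ (∃ w, Adj v w)) {l : List (V × ℕ)} (hne : l ≠ [])
    (hl : List.IsChain (fun p q => Adj p.1 q.1) l) (hlS : ∀ p ∈ l, p.2 ∈ S p.1) :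
    ∃ f : ℤ → V × ℕ, (∀ i, (f i).2 ∈ S (f i).1) ∧ (∀ i, Adj (f i).1 (f (i + 1)).1) ∧
      ∀ (i : ℕ) (hi : i < l.length), f i = l[i] := by
  choose s hs using hNe
  choose pre hpre using fun v => (hEss v).1
  choose suc hsuc using fun v => (hEss v).2
  have hlen : 0 < l.length := List.length_pos_iff.2 hne
  let g : ℕ → V × ℕ := fun n => Nat.rec l[0]
    (fun m p => if h : m + 1 < l.length then l[m + 1] else (suc p.1, s (suc p.1))) n
  have hg1 : ∀ m, g (m + 1) = if h : m + 1 < l.length then l[m + 1] else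
    (suc (g m).1, s (suc (g m).1)) := fun _ => rfl
  have hgl : ∀ (i : ℕ) (hi : i < l.length), g i = l[i] := by
    intro i hi
    cases i with
    | zero => rfl
    | succ i => rw [hg1, dif_pos hi]
  have hgS : ∀ i, (g i).2 ∈ S (g i).1 := by
    intro i
    cases i with
    | zero => exact hlS _ (List.getElem_mem hlen)
    | succ i =>
      rw [hg1]
      split_ifs with h
      · exact hlS _ (List.getElem_mem h)
      · exact hs _
  have hgadj : ∀ i, Adj (g i).1 (g (i + 1)).1 := by
    intro i
    by_cases h : i + 1 < l.length
    · rw [hgl i (by omega), hgl (i + 1) h]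
      exact List.isChain_iff_getElem.1 hl i h
    · rw [hg1, dif_neg h]
      exact hsuc _
  let b : ℕ → V := fun n => pre^[n] (g 0).1
  have hb : ∀ n, Adj (b (n + 1)) (b n) := fun n => by
    simp only [b, Function.iterate_succ_apply']
    exact hpre _
  refine ⟨fun i => match i with
    | Int.ofNat n => g n
    | Int.negSucc n => (b (n + 1), s (b (n + 1))), ?_, ?_, fun i hi => hgl i hi⟩
  · rintro (n | n)
    · exact hgS n
    · exact hs _
  · rintro (n | _ | n)
    · exact hgadj n
    · exact hb 0
    · exact hb (n + 1)

theorem inLanguage_spell (hNe : ∀ v, (S v).Nonempty) (hPos : ∀ v, 0 ∉ S v)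
    (hEss : ∀ v : V, (∃ u, Adj u v) ∧ (∃ w, Adj v w)) {l : List (V × ℕ)} (hne : l ≠ [])
    (hl : List.IsChain (fun p q => Adj p.1 q.1) l) (hlS : ∀ p ∈ l, p.2 ∈ S p.1) :
    InLanguage (SGraphCore Adj S) (spell l) := by
  obtain ⟨f, hfS, hfadj, hfl⟩ := exists_biinfinite_extension hNe hEss hne hl hlS
  obtain ⟨x, t, ht, hstep, hx, hmem⟩ := exists_core_point hPos f hfS hfadj
  have hruns : runs (fun i => (f i).1) t 0 l.length = l := by
    refine List.ext_getElem (by simp [runs]) fun i h1 h2 => ?_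
    simp [runs, hstep, ← hfl i h2]
  have := window_eq_spell_runs ht hx 0 l.length
  rw [hruns] at this
  exact ⟨x, hmem, this ▸ appears_window _ _ _⟩

theorem nonempty_SGraphCore [Nonempty V] (hNe : ∀ v, (S v).Nonempty) (hPos : ∀ v, 0 ∉ S v)
    (hEss : ∀ v : V, (∃ u, Adj u v) ∧ (∃ w, Adj v w)) : (SGraphCore Adj S).Nonempty := by
  inhabit V
  obtain ⟨s, hs⟩ := hNe default
  obtain ⟨x, hx, -⟩ := inLanguage_spell hNe hPos hEss (l := [(default, s)])
    (by simp) (by simp) (by simpa using hs)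
  exact ⟨x, hx⟩

theorem walkCoeff_le_wordCount [Finite V] (hLoop : ∀ v, ¬ Adj v v)
    (hNe : ∀ v, (S v).Nonempty) (hPos : ∀ v, 0 ∉ S v)
    (hEss : ∀ v : V, (∃ u, Adj u v) ∧ (∃ w, Adj v w)) (n : ℕ) :
    walkCoeff Adj S n ≤ wordCount (SGraphCore Adj S) n := by
  rw [walkCoeff_eq]
  refine Set.ncard_le_ncard_of_injOn spell ?_
    ((injOn_spell hLoop hPos n).mono fun l hl => hl.2) (finite_words _ n)
  rintro l ⟨hne, hl⟩
  exact ⟨(length_spell l).trans hl.2.2,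
    inLanguage_spell hNe hPos hEss hne hl.1 hl.2.1⟩

theorem frequently_walkCoeff_ne_zero [Finite V] (hLoop : ∀ v, ¬ Adj v v)
    (hPos : ∀ v, 0 ∉ S v) (hX : (SGraphCore Adj S).Nonempty) :
    ∃ᶠ n in atTop, walkCoeff Adj S n ≠ 0 := by
  obtain ⟨x, a, t, ht, hS, hadj, hx, -⟩ := hX
  rw [frequently_atTop]
  intro N
  refine ⟨((runs a t 0 (N + 1)).map Prod.snd).sum, ?_, ?_⟩
  · have hsum := sum_runs ht a 0 (N + 1)
    have hgrow : ∀ j : ℕ, (j : ℤ) ≤ t j - t 0 := fun j => by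
      induction j with
      | zero => simp
      | succ j ih =>
        have := ht (lt_add_one (j : ℤ))
        push_cast
        omega
    have := hgrow (N + 1)
    rw [zero_add] at hsum
    omega
  · rw [walkCoeff_eq, ← Nat.pos_iff_ne_zero, Set.ncard_pos
      ((finite_decoratedWalks hLoop hPos _).subset fun l hl => hl.2)]
    exact ⟨_, by simp [runs], runs_mem_decoratedWalks hS hadj _ _⟩

theorem exists_decomposition {w : List V} (hw : InLanguage (SGraphCore Adj S) w) :
    ∃ (u v : V) (p q m : ℕ), p ≤ w.length ∧ q ≤ w.length ∧ m ≤ w.length ∧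
      ∃ l ∈ decoratedWalks Adj S m, List.replicate p u ++ spell l ++ List.replicate q v = w := by
  obtain ⟨x, ⟨a, t, ht, hS, hadj, hx, hcov⟩, hwx⟩ := hw
  obtain ⟨k, hk⟩ := appears_iff_window.1 hwx
  set n := w.length
  obtain ⟨i, hi1, hi2⟩ := hcov k
  obtain ⟨i', hi1', hi2'⟩ := hcov (k + n)
  have hii : i < i' + 1 := ht.lt_iff_lt.1 (by omega)
  obtain rfl | hlt : i = i' ∨ i + 1 ≤ i' := by omega
  · refine ⟨a i, a i, n, 0, 0, le_rfl, by omega, by omega, [], ⟨by simp, by simp, by simp⟩, ?_⟩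
    rw [← hk, window_eq_replicate fun j h1 h2 => hx i j (by omega) (by omega)]
    simp
  · obtain ⟨j, hj⟩ := Int.le.dest hlt
    have hsum := sum_runs ht a (i + 1) j
    rw [hj] at hsum
    have hmono := ht.monotone hlt
    refine ⟨a i, a i', (t (i + 1) - k).toNat, (k + n - t i').toNat, _, by omega, by omega, ?_,
      runs a t (i + 1) j, runs_mem_decoratedWalks hS hadj _ _, ?_⟩
    · omega
    · rw [← window_eq_spell_runs ht hx,
        ← window_eq_replicate (x := x) (k := k) (n := (t (i + 1) - k).toNat)
          fun j h1 h2 => hx i j (by omega) (by omega),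
        ← window_eq_replicate (x := x) (k := t i') (n := (k + n - t i').toNat)
          fun j h1 h2 => hx i' j (by omega) (by omega)]
      set m := ((runs a t (i + 1) j).map Prod.snd).sum
      have e1 : t (i + 1) = k + (t (i + 1) - k).toNat := by omega
      have e2 : t i' = k + ((t (i + 1) - k).toNat + m : ℕ) := by omega
      have e3 : n = (t (i + 1) - k).toNat + m + (k + n - t i').toNat := by omega
      nth_rw 2 [e1]
      nth_rw 1 [e2]
      rw [← window_add, ← window_add, ← e3, hk]

theorem wordCount_le [Fintype V] (hLoop : ∀ v, ¬ Adj v v)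
    (hPos : ∀ v, 0 ∉ S v) (n : ℕ) (M : ℝ) (hM : ∀ m ≤ n, (walkCoeff Adj S m : ℝ) ≤ M) :
    (wordCount (SGraphCore Adj S) n : ℝ) ≤ (Fintype.card V : ℝ) ^ 2 * (n + 1) ^ 3 * (M + 1) := by
  let F : V × V × Fin (n + 1) × Fin (n + 1) × Fin (n + 1) → Set (List V) :=
    fun ⟨u, v, p, q, m⟩ =>
      (fun l => List.replicate p u ++ spell l ++ List.replicate q v) '' decoratedWalks Adj S m
  have hfin : ∀ y, (F y).Finite := fun ⟨u, v, p, q, m⟩ =>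
    (finite_decoratedWalks hLoop hPos _).image _
  have hcard : ∀ y, ((F y).ncard : ℝ) ≤ M + 1 := by
    rintro ⟨u, v, p, q, m⟩
    have h1 : (F (u, v, p, q, m)).ncard ≤ walkCoeff Adj S m + 1 :=
      (Set.ncard_image_le (finite_decoratedWalks hLoop hPos _)).trans
        (ncard_decoratedWalks_le hLoop hPos _)
    have h2 := hM m (by omega)
    have h3 : ((F (u, v, p, q, m)).ncard : ℝ) ≤ walkCoeff Adj S m + 1 := by exact_mod_cast h1
    linarith
  have hsub : {w : List V | w.length = n ∧ InLanguage (SGraphCore Adj S) w} ⊆ ⋃ y, F y := by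
    rintro w ⟨rfl, hw⟩
    obtain ⟨u, v, p, q, m, hp, hq, hm, l, hl, h⟩ := exists_decomposition hw
    exact Set.mem_iUnion.2 ⟨(u, v, ⟨p, by omega⟩, ⟨q, by omega⟩, ⟨m, by omega⟩), l, hl, h⟩
  have h1 : wordCount (SGraphCore Adj S) n ≤ ∑ y, (F y).ncard := by
    refine (Set.ncard_le_ncard hsub (Set.finite_iUnion hfin)).trans ?_
    simpa using Finset.univ.set_ncard_biUnion_le F
  calc (wordCount (SGraphCore Adj S) n : ℝ) ≤ ∑ y, ((F y).ncard : ℝ) := by exact_mod_cast h1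
    _ ≤ ∑ _y : V × V × Fin (n + 1) × Fin (n + 1) × Fin (n + 1), (M + 1) :=
      Finset.sum_le_sum fun y _ => hcard y
    _ = (Fintype.card V : ℝ) ^ 2 * (n + 1) ^ 3 * (M + 1) := by
      simp only [Finset.sum_const, Finset.card_univ, Fintype.card_prod, Fintype.card_fin,
        nsmul_eq_mul]
      push_cast
      ring

end Walks

/-- **Entropy via the walk generating series.**  Let `(G,S)` be an essential
set-equipped graph containing at least one cycle and `X = X(G,S)`.  If `λ` is
the radius of convergence of the power series `∑_{w ∈ W(G)} H_w(x)` (the series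
with coefficients `walkCoeff`), then the entropy of `X` is `log (1/λ)`. -/
theorem entropy_SGraphShift_walks {V : Type*} [Fintype V]
    [TopologicalSpace V] [DiscreteTopology V]
    (Adj : V → V → Prop) (S : V → Set ℕ)
    (hLoop : ∀ v, ¬ Adj v v)
    (hNe : ∀ v, (S v).Nonempty) (hPos : ∀ v, 0 ∉ S v)
    (hEss : ∀ v : V, (∃ u, Adj u v) ∧ (∃ w, Adj v w))
    (hCyc : ∃ l : List V, IsCycleList Adj l)
    (lam : ℝ) (hlam : 0 ≤ lam)
    (hconv : ∀ x : ℝ, 0 ≤ x → x < lam →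
      Summable (fun n : ℕ => (walkCoeff Adj S n : ℝ) * x ^ n))
    (hdiv : ∀ x : ℝ, lam < x →
      ¬ Summable (fun n : ℕ => (walkCoeff Adj S n : ℝ) * x ^ n)) :
    HasEntropy (closure (SGraphCore Adj S)) (Real.log (1 / lam)) := by
  obtain ⟨l, hl, -⟩ := hCyc
  have : Nonempty V := ⟨l.head hl⟩
  have hX : (SGraphCore Adj S).Nonempty := nonempty_SGraphCore hNe hPos hEss
  obtain ⟨h, hlim⟩ := exists_tendsto_log_wordCount hX
  have hb := one_le_wordCount hX
  have hlam' : lam = Real.exp (-h) := le_antisymm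
    (le_exp_neg_of_growth hb hlim (by positivity) (wordCount_le hLoop hPos)
      (frequently_walkCoeff_ne_zero hLoop hPos hX) hconv)
    (exp_neg_le_of_growth hb hlim (walkCoeff_le_wordCount hLoop hNe hPos hEss) hlam hdiv)
  rw [hlam', one_div, Real.log_inv, Real.log_exp, neg_neg]
  simpa only [HasEntropy, inLanguage_closure_iff, wordCount] using hlim
end

section
/- Let A be a p×p matrix over a field, with rows a_1,…,a_p, and suppose the m-th row satisfies a_m = x + y for row vectors x and y. Let A' be the (p+1)×(p+1) matrix obtained by replacing row a_m with the two consecutive rows x and y (yielding a (p+1)×p matrix) and then duplicating the m-th column. Then det(A' − ρI_{p+1}) = −ρ · det(A − ρI_p) for every scalar ρ; in particular, the spectrum of A' equals the spectrum of A together with the eigenvalue 0. -/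
/-- Given a `p × p` matrix `A`, an index `m` and row vectors `x`, `y`, the
`(p+1) × (p+1)` matrix obtained by replacing the `m`-th row of `A` with the two
consecutive rows `x` and `y`, and then duplicating the `m`-th column (inserting
directly after the `m`-th column a new column equal to it). -/
def rowSplit {K : Type*} {p : ℕ} (A : Matrix (Fin p) (Fin p) K)
    (m : Fin p) (x y : Fin p → K) : Matrix (Fin (p + 1)) (Fin (p + 1)) K :=
  fun i j =>
    let c : Fin p :=
      if h : (j : ℕ) ≤ (m : ℕ) then ⟨(j : ℕ), lt_of_le_of_lt h m.isLt⟩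
      else ⟨(j : ℕ) - 1, by have hj := j.isLt; omega⟩
    if h1 : (i : ℕ) < (m : ℕ) then A ⟨(i : ℕ), lt_trans h1 m.isLt⟩ c
    else if (i : ℕ) = (m : ℕ) then x c
    else if (i : ℕ) = (m : ℕ) + 1 then y c
    else A ⟨(i : ℕ) - 1, by have hi := i.isLt; omega⟩ c

open Matrix Polynomial

/-- The `(p+1) × p` matrix obtained from `A` by replacing its `m`-th row with the rows
`x` and `y`. -/
def splitRows {K : Type*} {p : ℕ} (A : Matrix (Fin p) (Fin p) K)
    (m : Fin p) (x y : Fin p → K) : Matrix (Fin (p + 1)) (Fin p) K :=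
  fun i c =>
    if h1 : (i : ℕ) < (m : ℕ) then A ⟨(i : ℕ), lt_trans h1 m.isLt⟩ c
    else if (i : ℕ) = (m : ℕ) then x c
    else if (i : ℕ) = (m : ℕ) + 1 then y c
    else A ⟨(i : ℕ) - 1, by have hi := i.isLt; omega⟩ c

/-- Right multiplication by this matrix duplicates the `m`-th column; left multiplication
adds up the rows `m` and `m + 1`. -/
def columnDup (K : Type*) [Zero K] [One K] {p : ℕ} (m : Fin p) :
    Matrix (Fin p) (Fin (p + 1)) K :=
  fun a j => if m.predAbove j = a then 1 else 0

theorem rowSplit_apply {K : Type*} {p : ℕ} (A : Matrix (Fin p) (Fin p) K)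
    (m : Fin p) (x y : Fin p → K) (i j : Fin (p + 1)) :
    rowSplit A m x y i j = splitRows A m x y i (m.predAbove j) := by
  have hc : m.predAbove j =
      if h : (j : ℕ) ≤ (m : ℕ) then ⟨(j : ℕ), lt_of_le_of_lt h m.isLt⟩
      else ⟨(j : ℕ) - 1, by have hj := j.isLt; omega⟩ := by
    split_ifs with h
    · rw [Fin.predAbove_of_le_castSucc _ _ (by simpa [Fin.le_def] using h)]
      rfl
    · rw [Fin.predAbove_of_castSucc_lt _ _ (by simpa [Fin.lt_def] using h)]
      rfl
  rw [hc]
  rfl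

theorem splitRows_mul_columnDup {K : Type*} [NonAssocSemiring K] {p : ℕ}
    (A : Matrix (Fin p) (Fin p) K) (m : Fin p) (x y : Fin p → K) :
    splitRows A m x y * columnDup K m = rowSplit A m x y := by
  ext i j
  simp [Matrix.mul_apply, columnDup, rowSplit_apply]

theorem splitRows_castSucc_succAbove {K : Type*} {p : ℕ} (A : Matrix (Fin p) (Fin p) K)
    (m : Fin p) (x y : Fin p → K) (a : Fin p) :
    splitRows A m x y (m.castSucc.succAbove a) = if m = a then y else A a := by
  ext b
  rcases lt_trichotomy a m with h | rfl | h
  · rw [Fin.succAbove_of_castSucc_lt _ _ (by simpa using h), if_neg h.ne']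
    simp [splitRows, h]
  · simp [splitRows]
  · rw [Fin.succAbove_of_le_castSucc _ _ (by simpa using h.le), if_neg h.ne]
    have h' : (m : ℕ) < a := h
    simp only [splitRows, Fin.val_succ]
    rw [dif_neg (by omega), if_neg (by omega), if_neg (by omega)]
    rfl

theorem columnDup_mul_splitRows {K : Type*} [NonAssocSemiring K] {p : ℕ}
    (A : Matrix (Fin p) (Fin p) K) (m : Fin p) (x y : Fin p → K)
    (hxy : ∀ j, A m j = x j + y j) :
    columnDup K m * splitRows A m x y = A := by
  ext a b
  have hx : splitRows A m x y m.castSucc = x := by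
    ext c
    simp [splitRows]
  rw [Matrix.mul_apply, Fin.sum_univ_succAbove _ m.castSucc]
  simp only [columnDup, Fin.predAbove_castSucc_self, Fin.predAbove_succAbove, ite_mul, one_mul,
    zero_mul, Finset.sum_ite_eq', Finset.mem_univ, if_true, hx, splitRows_castSucc_succAbove]
  by_cases h : m = a
  · subst h
    simp [hxy]
  · simp [h]

theorem charpoly_rowSplit {K : Type*} [CommRing K] {p : ℕ}
    (A : Matrix (Fin p) (Fin p) K) (m : Fin p) (x y : Fin p → K)
    (hxy : ∀ j, A m j = x j + y j) :
    (rowSplit A m x y).charpoly = X * A.charpoly := by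
  rw [← splitRows_mul_columnDup, Matrix.charpoly_mul_comm_of_le _ _ (by simp),
    columnDup_mul_splitRows A m x y hxy]
  simp

theorem det_sub_smul_one_eq_eval_charpoly {K n : Type*} [CommRing K] [Fintype n] [DecidableEq n]
    (M : Matrix n n K) (r : K) :
    (M - r • (1 : Matrix n n K)).det = (-1) ^ Fintype.card n * M.charpoly.eval r := by
  rw [Matrix.eval_charpoly, ← Matrix.det_neg, neg_sub, Matrix.scalar_apply,
    Matrix.smul_one_eq_diagonal]

/-- **Row-splitting and the spectrum.**  Let `A` be a `p × p` matrix over a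
field whose `m`-th row is `x + y`, and let `A'` be the `(p+1) × (p+1)` matrix
obtained by replacing row `m` with the rows `x`, `y` and duplicating the `m`-th
column.  Then `det (A' − ρ·I) = −ρ · det (A − ρ·I)` for every scalar `ρ`; in
particular the spectrum of `A'` is the spectrum of `A` together with `0`. -/
theorem rowSplit_charpoly_spectrum {K : Type*} [Field K] {p : ℕ}
    (A : Matrix (Fin p) (Fin p) K) (m : Fin p) (x y : Fin p → K)
    (hxy : ∀ j, A m j = x j + y j) :
    (∀ ρ : K,
      (rowSplit A m x y - ρ • (1 : Matrix (Fin (p + 1)) (Fin (p + 1)) K)).det =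
        -ρ * (A - ρ • (1 : Matrix (Fin p) (Fin p) K)).det) ∧
    spectrum K (rowSplit A m x y) = spectrum K A ∪ {0} := by
  have hchar := charpoly_rowSplit A m x y hxy
  refine ⟨fun ρ => ?_, ?_⟩
  · rw [det_sub_smul_one_eq_eval_charpoly, det_sub_smul_one_eq_eval_charpoly, hchar]
    simp only [Fintype.card_fin, eval_mul, eval_X]
    ring
  · ext μ
    rw [Set.mem_union, Set.mem_singleton_iff, Matrix.mem_spectrum_iff_isRoot_charpoly,
      Matrix.mem_spectrum_iff_isRoot_charpoly, hchar]
    simp [or_comm]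
end

section
/- Let (G,S) be a set-equipped graph, v ∈ V(G), and suppose S_v = T_1 ⊕ T_2 is a sum decomposition. Let (G',S') be the edge extension of (G,S) at v with respect to this decomposition. Then the S-graph shifts X(G,S) and X(G',S') have the same topological entropy, and X(G,S) is mixing if and only if X(G',S') is mixing. -/
open Filter Topology

/-- `X` is mixing. -/
def IsMixing {A : Type*} (X : Set (ℤ → A)) : Prop :=
  ∀ α β : List A, InLanguage X α → InLanguage X β →
    ∃ N : ℕ, ∀ n ≥ N, ∃ γ : List A, γ.length = n ∧ InLanguage X (α ++ γ ++ β)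

/-- The adjacency relation of the edge extension of `(G,S)` at the vertex `v`:
the new vertex `v'` (the `Sum.inr` vertex) receives the single edge `(v,v')`,
inherits the outgoing edges of `v`, all edges into `v` are kept, and the edges
of `G` between vertices other than `v` are kept. -/
def extAdj {V : Type*} (Adj : V → V → Prop) (v : V) :
    (V ⊕ Unit) → (V ⊕ Unit) → Prop
  | Sum.inl a, Sum.inl b => (b = v ∧ Adj a v) ∨ (a ≠ v ∧ b ≠ v ∧ Adj a b)
  | Sum.inl a, Sum.inr _ => a = v
  | Sum.inr _, Sum.inl b => Adj v b
  | Sum.inr _, Sum.inr _ => False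

/-- The vertex sets of the edge extension at `v` w.r.t. `S_v = T₁ ⊕ T₂`:
`v` gets `T₁`, the new vertex `v'` gets `T₂`, all other vertices keep their
sets. -/
def extS {V : Type*} [DecidableEq V] (S : V → Set ℕ) (v : V) (T₁ T₂ : Set ℕ) :
    (V ⊕ Unit) → Set ℕ
  | Sum.inl u => if u = v then T₁ else S u
  | Sum.inr _ => T₂

/-- The block `[a, b)` is a maximal interval on which `x` takes the constant value `u`. -/
def IsRun {A : Type*} (x : ℤ → A) (a b : ℤ) (u : A) : Prop :=
  a < b ∧ (∀ k, a ≤ k → k < b → x k = u) ∧ x (a - 1) ≠ u ∧ x b ≠ u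

/-- Every point of `x` lies in a bounded run. -/
def FiniteRuns {A : Type*} (x : ℤ → A) : Prop :=
  ∀ k, ∃ a b, a ≤ k ∧ k < b ∧ IsRun x a b (x k)

/-- For loopless graphs, the points of `SGraphCore` described through their runs. -/
def RunsAdmissible {A : Type*} (Adj : A → A → Prop) (S : A → Set ℕ) (x : ℤ → A) : Prop :=
  (∀ k, x k ≠ x (k + 1) → Adj (x k) (x (k + 1))) ∧
  (∀ a b u, IsRun x a b u → (b - a).toNat ∈ S u) ∧ FiniteRuns x

theorem IsRun.unique {A : Type*} {x : ℤ → A} {a b a' b' k : ℤ} {u u' : A}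
    (h : IsRun x a b u) (h' : IsRun x a' b' u') (ha : a ≤ k) (hb : k < b)
    (ha' : a' ≤ k) (hb' : k < b') : a = a' ∧ b = b' ∧ u = u' := by
  obtain ⟨-, hc, hl, hr⟩ := h
  obtain ⟨-, hc', hl', hr'⟩ := h'
  have hu : u = u' := (hc k ha hb).symm.trans (hc' k ha' hb')
  subst hu
  refine ⟨?_, ?_, rfl⟩
  · rcases lt_trichotomy a a' with h | h | h
    · exact absurd (hc (a' - 1) (by omega) (by omega)) hl'
    · exact h
    · exact absurd (hc' (a - 1) (by omega) (by omega)) hl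
  · rcases lt_trichotomy b b' with h | h | h
    · exact absurd (hc' b (by omega) (by omega)) hr
    · exact h
    · exact absurd (hc b' (by omega) (by omega)) hr'

theorem eq_of_forall_eq_pred {A : Type*} {x : ℤ → A} {a b : ℤ}
    (h : ∀ j, a < j → j < b → x (j - 1) = x j) (k : ℤ) (ha : a ≤ k) (hb : k < b) :
    x k = x a := by
  induction k, ha using Int.leInduction with
  | base => rfl
  | succ n hn ih =>
    have := h (n + 1) (by omega) hb
    rw [← ih (by omega), ← this]
    simp

theorem finiteRuns_of_changes {A : Type*} {x : ℤ → A}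
    (hup : ∀ m, ∃ k, m < k ∧ x (k - 1) ≠ x k) (hdown : ∀ m, ∃ k ≤ m, x (k - 1) ≠ x k) :
    FiniteRuns x := by
  intro m
  obtain ⟨a, ⟨ham, ha⟩, hamax⟩ := Int.exists_greatest_of_bdd
    (P := fun k => k ≤ m ∧ x (k - 1) ≠ x k) ⟨m, fun z hz => hz.1⟩ (hdown m)
  obtain ⟨b, ⟨hbm, hb⟩, hbmin⟩ := Int.exists_least_of_bdd
    (P := fun k => m < k ∧ x (k - 1) ≠ x k) ⟨m, fun z hz => hz.1.le⟩ (hup m)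
  have hconst : ∀ k, a ≤ k → k < b → x k = x a := by
    refine eq_of_forall_eq_pred fun j hj hj' => ?_
    by_contra hne
    rcases le_or_gt j m with h | h
    · have := hamax j ⟨h, hne⟩
      omega
    · have := hbmin j ⟨h, hne⟩
      omega
  have hm := hconst m ham hbm
  refine ⟨a, b, ham, hbm, by omega, fun k h h' => by rw [hm, hconst k h h'], ?_, ?_⟩
  · rwa [hm]
  · rw [hm, ← hconst (b - 1) (by omega) (by omega)]
    exact hb.symm

theorem exists_strictMono_range_eq {B : Set ℤ} (hup : ∀ m, ∃ k ∈ B, m < k)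
    (hdown : ∀ m, ∃ k ∈ B, k < m) : ∃ t : ℤ → ℤ, StrictMono t ∧ Set.range t = B := by
  classical
  let _ : SuccOrder B := LinearLocallyFiniteOrder.succOrder B
  let _ : PredOrder B := LinearLocallyFiniteOrder.predOrder B
  have : NoMaxOrder B := ⟨fun a => by
    obtain ⟨k, hk, h⟩ := hup a
    exact ⟨⟨k, hk⟩, h⟩⟩
  have : NoMinOrder B := ⟨fun a => by
    obtain ⟨k, hk, h⟩ := hdown a
    exact ⟨⟨k, hk⟩, h⟩⟩
  have : Nonempty B := by
    obtain ⟨k, hk, -⟩ := hup 0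
    exact ⟨⟨k, hk⟩⟩
  let e : B ≃o ℤ := orderIsoIntOfLinearSuccPredArch
  refine ⟨fun i => e.symm i, fun i j h => e.symm.strictMono h, ?_⟩
  ext k
  constructor
  · rintro ⟨i, rfl⟩
    exact (e.symm i).2
  · intro hk
    exact ⟨e ⟨k, hk⟩, by simp⟩

theorem mem_sGraphCore_iff_runsAdmissible {A : Type*} {Adj : A → A → Prop} {S : A → Set ℕ}
    (hLoop : ∀ u, ¬ Adj u u) {x : ℤ → A} :
    x ∈ SGraphCore Adj S ↔ RunsAdmissible Adj S x := by
  constructor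
  · rintro ⟨a, t, ht, hS, hA, hx, hcov⟩
    have hlt : ∀ i, t i < t (i + 1) := fun i => ht (by omega)
    have hl : ∀ i, x (t i) = a i := fun i => hx i _ le_rfl (hlt i)
    have hr : ∀ i, x (t i - 1) = a (i - 1) := fun i => by
      have := hlt (i - 1)
      rw [sub_add_cancel] at this
      exact hx (i - 1) _ (by omega) (by rw [sub_add_cancel]; omega)
    have hne : ∀ i, a i ≠ a (i + 1) := fun i h => hLoop (a i) (by
      have := hA i
      rwa [← h] at this)
    have hrun : ∀ i, IsRun x (t i) (t (i + 1)) (a i) := fun i => by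
      refine ⟨hlt i, hx i, ?_, ?_⟩
      · rw [hr]
        simpa using hne (i - 1)
      · rw [hl]
        exact (hne i).symm
    refine ⟨fun k hk => ?_, fun b c u hbc => ?_, fun k => ?_⟩
    · obtain ⟨i, hi, hi'⟩ := hcov k
      rcases lt_or_ge (k + 1) (t (i + 1)) with h | h
      · exact absurd ((hx i k hi hi').trans (hx i (k + 1) (by omega) h).symm) hk
      · have hkt : k + 1 = t (i + 1) := by omega
        rw [hkt, hl, hx i k hi hi']
        exact hA i
    · obtain ⟨i, hi, hi'⟩ := hcov b
      obtain ⟨rfl, rfl, rfl⟩ := hbc.unique (hrun i) le_rfl hbc.1 hi hi'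
      exact hS i
    · obtain ⟨i, hi, hi'⟩ := hcov k
      refine ⟨t i, t (i + 1), hi, hi', ?_⟩
      rw [hx i k hi hi']
      exact hrun i
  · rintro ⟨hA, hS, hfin⟩
    have hup : ∀ m, ∃ k ∈ {k | x (k - 1) ≠ x k}, m < k := fun m => by
      obtain ⟨a, b, ha, hb, hr⟩ := hfin m
      refine ⟨b, ?_, hb⟩
      rw [Set.mem_ofPred_eq, hr.2.1 (b - 1) (by omega) (by omega)]
      exact hr.2.2.2.symm
    have hdown : ∀ m, ∃ k ∈ {k | x (k - 1) ≠ x k}, k < m := fun m => by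
      obtain ⟨a, b, ha, hb, hr⟩ := hfin (m - 1)
      refine ⟨a, ?_, by omega⟩
      rw [Set.mem_ofPred_eq, hr.2.1 a (by omega) (by omega)]
      exact hr.2.2.1
    obtain ⟨t, ht, hrange⟩ := exists_strictMono_range_eq hup hdown
    have hlt : ∀ i, t i < t (i + 1) := fun i => ht (by omega)
    have hbd : ∀ i, x (t i - 1) ≠ x (t i) := fun i => by
      have : t i ∈ Set.range t := ⟨i, rfl⟩
      rwa [hrange] at this
    have hconst : ∀ i k, t i ≤ k → k < t (i + 1) → x k = x (t i) := fun i => by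
      refine eq_of_forall_eq_pred fun j hj hj' => ?_
      by_contra hne
      have : j ∈ Set.range t := by rw [hrange]; exact hne
      obtain ⟨l, rfl⟩ := this
      have h1 := ht.lt_iff_lt.1 hj
      have h2 := ht.lt_iff_lt.1 hj'
      omega
    have hend : ∀ i, x (t (i + 1) - 1) = x (t i) := fun i => by
      have := hlt i
      exact hconst i _ (by omega) (by omega)
    refine ⟨fun i => x (t i), t, ht, fun i => ?_, fun i => ?_, hconst, fun m => ?_⟩
    · refine hS _ _ _ ⟨hlt i, hconst i, hbd i, ?_⟩
      have := (hbd (i + 1)).symm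
      rwa [hend] at this
    · have := hA (t (i + 1) - 1)
      rw [sub_add_cancel, hend] at this
      refine this ?_
      rw [← hend]
      exact hbd (i + 1)
    · obtain ⟨b, hb, hbm⟩ := hup m
      rw [← hrange] at hb
      obtain ⟨j, rfl⟩ := hb
      obtain ⟨c, hc, hcm⟩ := hdown m
      rw [← hrange] at hc
      obtain ⟨l, rfl⟩ := hc
      obtain ⟨i, hi, himax⟩ := Int.exists_greatest_of_bdd (P := fun i => t i ≤ m)
        ⟨j, fun z hz => (ht.lt_iff_lt.1 (lt_of_le_of_lt hz hbm)).le⟩ ⟨l, hcm.le⟩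
      refine ⟨i, hi, ?_⟩
      by_contra h
      have := himax (i + 1) (not_lt.1 h)
      omega

/-- The vertex map of the edge extension at `v` collapsing the new vertex onto `v`. -/
def collapse {V : Type*} (v : V) : V ⊕ Unit → V := Sum.elim id fun _ => v

theorem extAdj_loopless {V : Type*} {Adj : V → V → Prop} (v : V) (hLoop : ∀ u, ¬ Adj u u) :
    ∀ u, ¬ extAdj Adj v u u := by
  rintro (u | u)
  · rintro (⟨rfl, h⟩ | ⟨-, -, h⟩) <;> exact hLoop _ h
  · exact id

theorem collapse_eq_self_iff {V : Type*} {v : V} {s : V ⊕ Unit} :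
    collapse v s = v ↔ s = Sum.inl v ∨ s = Sum.inr () := by
  rcases s with s | s <;> simp [collapse]

theorem collapse_eq_iff_of_ne {V : Type*} {v u : V} (hu : u ≠ v) {s : V ⊕ Unit} :
    collapse v s = u ↔ s = Sum.inl u := by
  rcases s with s | s <;> simp [collapse, hu.symm]

theorem IsRun.exists_split {V : Type*} [DecidableEq V] {Adj : V → V → Prop} {S : V → Set ℕ}
    {v : V} {T₁ T₂ : Set ℕ} (hLoop : ∀ u, ¬ Adj u u) {x : ℤ → V ⊕ Unit}
    (hx : RunsAdmissible (extAdj Adj v) (extS S v T₁ T₂) x) {a b : ℤ}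
    (h : IsRun (collapse v ∘ x) a b v) :
    ∃ c, IsRun x a c (Sum.inl v) ∧ IsRun x c b (Sum.inr ()) := by
  obtain ⟨hA, -, hfin⟩ := hx
  obtain ⟨hab, hc, hl, hr⟩ := h
  simp only [Function.comp_apply] at hc hl hr
  have hl' := mt collapse_eq_self_iff.2 hl
  have hr' := mt collapse_eq_self_iff.2 hr
  push Not at hl' hr'
  have hxa : x a = Sum.inl v := by
    refine (collapse_eq_self_iff.1 (hc a le_rfl hab)).resolve_right fun h => ?_
    have := hA (a - 1)
    rw [sub_add_cancel, h] at this
    have := this hl'.2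
    rcases hs : x (a - 1) with u | u
    · rw [hs] at this hl'
      exact hl'.1 (congrArg _ this)
    · rw [hs] at hl'
      exact hl'.2 rfl
  obtain ⟨a', c, ha', hac, hrun⟩ := hfin a
  rw [hxa] at hrun
  have haa' : a' = a := by
    by_contra hne
    exact hl'.1 (hrun.2.1 (a - 1) (by omega) (by omega))
  subst haa'
  have hcb : c ≤ b := by
    by_contra hlt
    exact hr'.1 (hrun.2.1 b (by omega) (by omega))
  have hxc1 : x (c - 1) = Sum.inl v := hrun.2.1 _ (by omega) (by omega)
  have hxc : x c = Sum.inr () := by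
    have := hA (c - 1)
    rw [sub_add_cancel, hxc1] at this
    have := this hrun.2.2.2.symm
    rcases hs : x c with u | u
    · rw [hs] at this
      rcases this with ⟨-, h⟩ | ⟨h, -⟩
      · exact absurd h (hLoop v)
      · exact absurd rfl h
    · rfl
  have hcb' : c ≠ b := by
    rintro rfl
    exact hr'.2 hxc
  obtain ⟨c', b', hc', hcb'', hrun'⟩ := hfin c
  rw [hxc] at hrun'
  have hcc' : c' = c := by
    by_contra hne
    have := hrun'.2.1 (c - 1) (by omega) (by omega)
    rw [hxc1] at this
    cases this
  subst hcc'
  have hb'b : b' ≤ b := by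
    by_contra hlt
    exact hr'.2 (hrun'.2.1 b (by omega) (by omega))
  have hb' : b' = b := by
    by_contra hne
    have hxb' := (collapse_eq_self_iff.1 (hc b' (by omega) (by omega))).resolve_right hrun'.2.2.2
    have := hA (b' - 1)
    rw [sub_add_cancel, hxb', hrun'.2.1 (b' - 1) (by omega) (by omega)] at this
    exact hLoop v (this (by simp))
  subst hb'
  exact ⟨c', hrun, hrun'⟩

theorem RunsAdmissible.collapse_comp {V : Type*} [DecidableEq V] {Adj : V → V → Prop}
    {S : V → Set ℕ} {v : V} {T₁ T₂ : Set ℕ} (hLoop : ∀ u, ¬ Adj u u)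
    (hsum : ∀ s, s ∈ S v ↔ ∃ t₁ ∈ T₁, ∃ t₂ ∈ T₂, s = t₁ + t₂) {x : ℤ → V ⊕ Unit}
    (hx : RunsAdmissible (extAdj Adj v) (extS S v T₁ T₂) x) :
    RunsAdmissible Adj S (collapse v ∘ x) := by
  have hadj : ∀ k, (collapse v ∘ x) k ≠ (collapse v ∘ x) (k + 1) →
      Adj ((collapse v ∘ x) k) ((collapse v ∘ x) (k + 1)) := fun k hk => by
    simp only [Function.comp_apply] at hk ⊢
    have := hx.1 k fun h => hk (by rw [h])
    revert this hk
    rcases x k with s | s <;> rcases x (k + 1) with s' | s' <;>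
      simp only [collapse, Sum.elim_inl, Sum.elim_inr, id, extAdj]
    · rintro - (⟨rfl, h⟩ | ⟨-, -, h⟩) <;> exact h
    · exact fun h h' => absurd h' h
    · exact fun _ h => h
    · exact fun _ h => h.elim
  have hch : ∀ m, x (m - 1) ≠ x m →
      (collapse v ∘ x) (m - 1) ≠ (collapse v ∘ x) m ∨
        (x (m - 1) = Sum.inl v ∧ x m = Sum.inr ()) := fun m hm => by
    have := hx.1 (m - 1)
    rw [sub_add_cancel] at this
    have := this hm
    simp only [Function.comp_apply]
    revert this hm
    rcases x (m - 1) with s | s <;> rcases x m with s' | s' <;>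
      simp only [collapse, Sum.elim_inl, Sum.elim_inr, id, extAdj]
    · exact fun h _ => Or.inl fun h' => h (congrArg _ h')
    · rintro - rfl
      exact Or.inr ⟨rfl, trivial⟩
    · rintro - h
      refine Or.inl ?_
      rintro rfl
      exact hLoop _ h
    · exact fun _ h => h.elim
  have hup : ∀ m, ∃ k, m < k ∧ x (k - 1) ≠ x k ∧ x (k - 1) = x m := fun m => by
    obtain ⟨a, b, ha, hb, hr⟩ := hx.2.2 m
    have := hr.2.1 (b - 1) (by omega) (by omega)
    exact ⟨b, hb, by rw [this]; exact hr.2.2.2.symm, this⟩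
  have hdown : ∀ m, ∃ k ≤ m, x (k - 1) ≠ x k ∧ x k = x m := fun m => by
    obtain ⟨a, b, ha, hb, hr⟩ := hx.2.2 m
    have := hr.2.1 a (by omega) (by omega)
    exact ⟨a, ha, by rw [this]; exact hr.2.2.1, this⟩
  refine ⟨hadj, fun a b u hr => ?_, finiteRuns_of_changes (fun m => ?_) (fun m => ?_)⟩
  · rcases eq_or_ne u v with rfl | hu
    · obtain ⟨c, h₁, h₂⟩ := hr.exists_split hLoop hx
      have m₁ := hx.2.1 _ _ _ h₁
      have m₂ := hx.2.1 _ _ _ h₂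
      simp only [extS, if_true] at m₁ m₂
      refine (hsum _).2 ⟨_, m₁, _, m₂, ?_⟩
      have := h₁.1
      have := h₂.1
      omega
    · have : IsRun x a b (Sum.inl u) := by
        refine ⟨hr.1, fun k h h' => (collapse_eq_iff_of_ne hu).1 (hr.2.1 k h h'), ?_, ?_⟩
        · exact fun h => hr.2.2.1 ((collapse_eq_iff_of_ne hu).2 h)
        · exact fun h => hr.2.2.2 ((collapse_eq_iff_of_ne hu).2 h)
      have := hx.2.1 _ _ _ this
      rwa [extS, if_neg hu] at this
  · obtain ⟨k, hk, hne, -⟩ := hup m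
    rcases hch k hne with h | ⟨-, h⟩
    · exact ⟨k, hk, h⟩
    · obtain ⟨l, hl, hne', heq⟩ := hup k
      refine ⟨l, hk.trans hl, (hch l hne').resolve_right fun h' => ?_⟩
      rw [h, h'.1] at heq
      cases heq
  · obtain ⟨k, hk, hne, -⟩ := hdown m
    rcases hch k hne with h | ⟨h, -⟩
    · exact ⟨k, hk, h⟩
    · obtain ⟨l, hl, hne', heq⟩ := hdown (k - 1)
      refine ⟨l, by omega, (hch l hne').resolve_right fun h' => ?_⟩
      rw [h, h'.2] at heq
      cases heq

theorem exists_runsAdmissible_lift {V : Type*} [DecidableEq V] {Adj : V → V → Prop}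
    {S : V → Set ℕ} {v : V} {T₁ T₂ : Set ℕ}
    (hT₁0 : 0 ∉ T₁) (hT₂0 : 0 ∉ T₂)
    (hsum : ∀ s, s ∈ S v ↔ ∃ t₁ ∈ T₁, ∃ t₂ ∈ T₂, s = t₁ + t₂)
    (huniq : ∀ t₁ ∈ T₁, ∀ t₂ ∈ T₂, ∀ t₁' ∈ T₁, ∀ t₂' ∈ T₂,
      t₁ + t₂ = t₁' + t₂' → t₁ = t₁' ∧ t₂ = t₂') {x : ℤ → V} (hx : RunsAdmissible Adj S x) :
    ∃ y, RunsAdmissible (extAdj Adj v) (extS S v T₁ T₂) y ∧ collapse v ∘ y = x := by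
  classical
  obtain ⟨hA, hS, hfin⟩ := hx
  let P : ℤ → Prop := fun k => ∃ a b, ∃ t₁ ∈ T₁, ∃ t₂ ∈ T₂, IsRun x a b v ∧ a ≤ k ∧ k < b ∧
    (b - a).toNat = t₁ + t₂ ∧ k < a + t₁
  let y : ℤ → V ⊕ Unit := fun k =>
    if x k = v then (if P k then Sum.inl v else Sum.inr ()) else Sum.inl (x k)
  have hyx : ∀ k, collapse v (y k) = x k := fun k => by
    simp only [y]
    split_ifs with h <;> simp [collapse, h]
  have hy_of_ne : ∀ k, x k ≠ v → y k = Sum.inl (x k) := fun k h => if_neg h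
  have hsplit : ∀ k, x k = v → ∃ a c b, a ≤ k ∧ k < b ∧ IsRun x a b v ∧ IsRun y a c (Sum.inl v) ∧
      IsRun y c b (Sum.inr ()) ∧ (c - a).toNat ∈ T₁ ∧ (b - c).toNat ∈ T₂ := fun k hk => by
    obtain ⟨a, b, ha, hb, hr⟩ := hfin k
    rw [hk] at hr
    obtain ⟨t₁, ht₁, t₂, ht₂, heq⟩ := (hsum _).1 (hS _ _ _ hr)
    have hP : ∀ j, a ≤ j → j < b → (P j ↔ j < a + t₁) := fun j hj hj' => by
      constructor
      · rintro ⟨a', b', t₁', ht₁', t₂', ht₂', hr', ha', hb', heq', hlt⟩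
        obtain ⟨rfl, rfl, -⟩ := hr.unique hr' hj hj' ha' hb'
        obtain ⟨rfl, rfl⟩ := huniq _ ht₁ _ ht₂ _ ht₁' _ ht₂' (heq.symm.trans heq')
        exact hlt
      · exact fun h => ⟨a, b, t₁, ht₁, t₂, ht₂, hr, hj, hj', heq, h⟩
    have h₁ : t₁ ≠ 0 := fun h => hT₁0 (h ▸ ht₁)
    have h₂ : t₂ ≠ 0 := fun h => hT₂0 (h ▸ ht₂)
    have hinl : ∀ j, a ≤ j → j < a + t₁ → y j = Sum.inl v := fun j hj hj' => by
      simp only [y]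
      rw [if_pos (hr.2.1 j hj (by omega)), if_pos ((hP j hj (by omega)).2 hj')]
    have hinr : ∀ j, a + t₁ ≤ j → j < b → y j = Sum.inr () := fun j hj hj' => by
      simp only [y]
      rw [if_pos (hr.2.1 j (by omega) hj'), if_neg (mt (hP j (by omega) hj').1 (by omega))]
    refine ⟨a, a + t₁, b, ha, hb, hr, ⟨by omega, hinl, ?_, ?_⟩, ⟨by omega, hinr, ?_, ?_⟩, ?_, ?_⟩
    · rw [hy_of_ne _ hr.2.2.1]
      simpa using hr.2.2.1
    · rw [hinr _ le_rfl (by omega)]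
      simp
    · rw [hinl _ (by omega) (by omega)]
      simp
    · rw [hy_of_ne _ hr.2.2.2]
      simp
    · rwa [show (a + t₁ - a).toNat = t₁ by omega]
    · rwa [show (b - (a + t₁)).toNat = t₂ by omega]
  refine ⟨y, ⟨fun k hk => ?_, fun a b u hr => ?_, finiteRuns_of_changes (fun m => ?_) fun m => ?_⟩,
    funext hyx⟩
  · by_cases h : x k = v
    · obtain ⟨a, c, b, ha, hb, hr, hl, hr', -, -⟩ := hsplit k h
      rcases lt_or_ge k c with hkc | hkc
      · have h1 := hl.2.1 k ha hkc
        have h2 : k + 1 = c := by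
          by_contra hne
          exact hk (h1.trans (hl.2.1 (k + 1) (by omega) (by omega)).symm)
        rw [h1, h2, hr'.2.1 c le_rfl hr'.1]
        rfl
      · have h1 := hr'.2.1 k hkc hb
        have h2 : k + 1 = b := by
          by_contra hne
          exact hk (h1.trans (hr'.2.1 (k + 1) (by omega) (by omega)).symm)
        have h3 := hA k
        rw [h1, h2, hy_of_ne _ hr.2.2.2]
        rw [h2, h] at h3
        exact h3 hr.2.2.2.symm
    · rw [hy_of_ne k h] at hk ⊢
      by_cases h' : x (k + 1) = v
      · have h3 := hA k
        rw [h'] at h3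
        obtain ⟨a, c, b, ha, hb, hr, hl, hr', -, -⟩ := hsplit _ h'
        have hak : a = k + 1 := by
          by_contra hne
          exact h (hr.2.1 k (by omega) (by omega))
        rw [hl.2.1 (k + 1) ha (by have := hl.1; omega)]
        exact Or.inl ⟨rfl, h3 h⟩
      · rw [hy_of_ne _ h'] at hk ⊢
        exact Or.inr ⟨h, h', hA k fun h => hk (congrArg _ h)⟩
  · have hya := hr.2.1 a le_rfl hr.1
    by_cases h : x a = v
    · obtain ⟨a', c, b', ha, hb, -, hl, hr', m₁, m₂⟩ := hsplit a h
      rcases lt_or_ge a c with hac | hac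
      · obtain ⟨rfl, rfl, rfl⟩ := hr.unique hl le_rfl hr.1 ha hac
        simpa [extS] using m₁
      · obtain ⟨rfl, rfl, rfl⟩ := hr.unique hr' le_rfl hr.1 hac hb
        exact m₂
    · rw [hy_of_ne a h] at hya
      subst hya
      rw [extS, if_neg h]
      refine hS _ _ _ ⟨hr.1, fun k hk hk' => ?_, fun h' => ?_, fun h' => ?_⟩
      · rw [← hyx k, hr.2.1 k hk hk']
        rfl
      · exact hr.2.2.1 (by rw [hy_of_ne _ (h' ▸ h), h'])
      · exact hr.2.2.2 (by rw [hy_of_ne _ (h' ▸ h), h'])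
  · obtain ⟨a, b, ha, hb, hr⟩ := hfin m
    refine ⟨b, hb, fun h => hr.2.2.2 ?_⟩
    rw [← hyx b, ← h, hyx, hr.2.1 _ (by omega) (by omega)]
  · obtain ⟨a, b, ha, hb, hr⟩ := hfin m
    refine ⟨a, ha, fun h => hr.2.2.1 ?_⟩
    rw [← hyx (a - 1), h, hyx, hr.2.1 _ (by omega) (by omega)]

theorem eqOn_of_collapse_eqOn {V : Type*} [DecidableEq V] {Adj : V → V → Prop}
    {S : V → Set ℕ} {v : V} {T₁ T₂ : Set ℕ} (hLoop : ∀ u, ¬ Adj u u)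
    (huniq : ∀ t₁ ∈ T₁, ∀ t₂ ∈ T₂, ∀ t₁' ∈ T₁, ∀ t₂' ∈ T₂,
      t₁ + t₂ = t₁' + t₂' → t₁ = t₁' ∧ t₂ = t₂') {x y : ℤ → V ⊕ Unit}
    (hx : RunsAdmissible (extAdj Adj v) (extS S v T₁ T₂) x)
    (hy : RunsAdmissible (extAdj Adj v) (extS S v T₁ T₂) y)
    (hxf : FiniteRuns (collapse v ∘ x)) {p q : ℤ}
    (heq : ∀ k, p ≤ k → k ≤ q → collapse v (x k) = collapse v (y k))
    (hp : collapse v (x p) ≠ v) (hq : collapse v (x q) ≠ v) (k : ℤ) (hpk : p ≤ k) (hkq : k ≤ q) :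
    x k = y k := by
  have hk := heq k hpk hkq
  by_cases h : collapse v (x k) = v
  · obtain ⟨a, b, ha, hb, hr⟩ := hxf k
    simp only [Function.comp_apply, h] at hr
    have hpa : p < a := by
      by_contra hlt
      exact hp (hr.2.1 p (by omega) (by omega))
    have hbq : b ≤ q := by
      by_contra hlt
      exact hq (hr.2.1 q (by omega) (by omega))
    have hab := hr.1
    have hr' : IsRun (collapse v ∘ y) a b v := by
      refine ⟨hab, fun j hj hj' => ?_, ?_, ?_⟩
      · exact (heq j (by omega) (by omega)).symm.trans (hr.2.1 j hj hj')
      · exact fun h => hr.2.2.1 ((heq _ (by omega) (by omega)).trans h)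
      · exact fun h => hr.2.2.2 ((heq _ (by omega) (by omega)).trans h)
    obtain ⟨c, h₁, h₂⟩ := hr.exists_split hLoop hx
    obtain ⟨d, h₁', h₂'⟩ := hr'.exists_split hLoop hy
    have m₁ := hx.2.1 _ _ _ h₁
    have m₂ := hx.2.1 _ _ _ h₂
    have m₁' := hy.2.1 _ _ _ h₁'
    have m₂' := hy.2.1 _ _ _ h₂'
    simp only [extS, if_true] at m₁ m₂ m₁' m₂'
    have hlt₁ := h₁.1
    have hlt₂ := h₂.1
    have hlt₁' := h₁'.1
    have hlt₂' := h₂'.1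
    have := (huniq _ m₁ _ m₂ _ m₁' _ m₂' (by omega)).1
    obtain rfl : c = d := by omega
    rcases lt_or_ge k c with hkc | hkc
    · rw [h₁.2.1 k ha hkc, h₁'.2.1 k ha hkc]
    · rw [h₂.2.1 k hkc hb, h₂'.2.1 k hkc hb]
  · have hxk : x k = Sum.inl (collapse v (x k)) := (collapse_eq_iff_of_ne h).1 rfl
    exact hxk.trans ((collapse_eq_iff_of_ne h).1 hk.symm).symm

theorem sGraphCore_shift {A : Type*} {Adj : A → A → Prop} {S : A → Set ℕ} {x : ℤ → A}
    (hx : x ∈ SGraphCore Adj S) (m : ℤ) : (fun k => x (k + m)) ∈ SGraphCore Adj S := by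
  obtain ⟨a, t, ht, hS, hA, hc, hcov⟩ := hx
  refine ⟨a, fun i => t i - m, fun i j h => ?_, fun i => ?_, hA, fun i k h h' => ?_, fun k => ?_⟩
  · exact sub_lt_sub_right (ht h) m
  · simpa using hS i
  · simp only at h h'
    exact hc i _ (by omega) (by omega)
  · obtain ⟨i, h, h'⟩ := hcov (k + m)
    simp only
    exact ⟨i, by omega, by omega⟩

/-- The word `w` is read in `x` from position `k` on. -/
def MatchesAt {A : Type*} (x : ℤ → A) (k : ℤ) (w : List A) : Prop :=
  ∀ (i : ℕ) (h : i < w.length), x (k + i) = w[i]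

theorem matchesAt_append {A : Type*} {x : ℤ → A} {k : ℤ} {a b : List A} :
    MatchesAt x k (a ++ b) ↔ MatchesAt x k a ∧ MatchesAt x (k + a.length) b := by
  constructor
  · refine fun h => ⟨fun i hi => ?_, fun i hi => ?_⟩
    · rw [h i (by simp; omega), List.getElem_append_left hi]
    · have := h (a.length + i) (by simp; omega)
      rw [List.getElem_append_right (by omega)] at this
      simpa [add_assoc] using this
  · rintro ⟨ha, hb⟩ i hi
    rcases lt_or_ge i a.length with h | h
    · rw [ha i h, List.getElem_append_left h]
    · rw [List.getElem_append_right h, ← hb (i - a.length) (by simp at hi; omega)]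
      congr 1
      omega

theorem inLanguage_closure_iff_s15 {A : Type*} [TopologicalSpace A] [DiscreteTopology A]
    {C : Set (ℤ → A)} (hC : ∀ x ∈ C, ∀ m : ℤ, (fun k => x (k + m)) ∈ C) {w : List A} :
    InLanguage (closure C) w ↔ ∃ x ∈ C, MatchesAt x 0 w := by
  constructor
  · rintro ⟨x, hx, k, hk⟩
    have hopen : IsOpen (⋂ i : Fin w.length, {y : ℤ → A | y (k + (i : ℕ)) = w.get i}) :=
      isOpen_iInter_of_finite fun i =>
        (isOpen_discrete {w.get i}).preimage
          (continuous_apply (A := fun _ : ℤ => A) (k + ((i : ℕ) : ℤ)))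
    obtain ⟨y, hy, hyC⟩ := mem_closure_iff.1 hx _ hopen (Set.mem_iInter.2 hk)
    refine ⟨_, hC y hyC k, fun i hi => ?_⟩
    have := Set.mem_iInter.1 hy ⟨i, hi⟩
    simpa [add_comm] using this
  · rintro ⟨x, hx, h⟩
    exact ⟨x, subset_closure hx, 0, fun i => h i i.2⟩

theorem isMixing_closure_iff {A : Type*} [TopologicalSpace A] [DiscreteTopology A]
    {C : Set (ℤ → A)} (hC : ∀ x ∈ C, ∀ m : ℤ, (fun k => x (k + m)) ∈ C) :
    IsMixing (closure C) ↔ ∀ x ∈ C, ∀ y ∈ C, ∀ M : ℤ, ∃ N : ℤ, ∀ l ≥ N, ∃ z ∈ C,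
      (∀ i, -M ≤ i → i ≤ M → z i = x i) ∧ ∀ i, -M ≤ i → i ≤ M → z (l + i) = y i := by
  simp only [IsMixing, inLanguage_closure_iff_s15 hC, matchesAt_append]
  constructor
  · intro h x hx y hy M
    let w : (ℤ → A) → List A := fun x => List.ofFn fun i : Fin (2 * M + 1).toNat => x (i - M)
    have hw : ∀ x ∈ C, ∃ z ∈ C, MatchesAt z 0 (w x) := fun x hx =>
      ⟨_, hC x hx (-M), fun i hi => by simp [w, sub_eq_add_neg]⟩
    obtain ⟨N, hN⟩ := h _ _ (hw x hx) (hw y hy)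
    refine ⟨N + (2 * M + 1).toNat, fun l hl => ?_⟩
    obtain ⟨γ, hγ, z, hz, ⟨hzx, -⟩, hzy⟩ := hN (l - (2 * M + 1).toNat).toNat (by omega)
    refine ⟨_, hC z hz M, fun i hi hi' => ?_, fun i hi hi' => ?_⟩
    · have := hzx (i + M).toNat (by simp [w]; omega)
      simp only [w, List.getElem_ofFn] at this
      convert this using 2 <;> omega
    · have := hzy (i + M).toNat (by simp [w]; omega)
      simp only [w, List.getElem_ofFn, List.length_append, List.length_ofFn, hγ] at this
      convert this using 2 <;> omega
  · rintro h α β ⟨x, hx, hα⟩ ⟨y, hy, hβ⟩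
    obtain ⟨N, hN⟩ := h x hx y hy (max α.length β.length)
    refine ⟨N.toNat, fun n hn => ?_⟩
    obtain ⟨z, hz, hzx, hzy⟩ := hN (α.length + n) (by omega)
    refine ⟨List.ofFn fun i : Fin n => z (α.length + i), by simp, z, hz, ⟨fun i hi => ?_,
      fun i hi => ?_⟩, fun i hi => ?_⟩
    · rw [← hα i hi]
      exact hzx _ (by omega) (by omega)
    · simp
    · rw [← hβ i hi, zero_add (i : ℤ), ← hzy i (by omega) (by omega)]
      simp

theorem ncard_inLanguage_closure {A : Type*} [TopologicalSpace A] [DiscreteTopology A]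
    {C : Set (ℤ → A)} (hC : ∀ x ∈ C, ∀ m : ℤ, (fun k => x (k + m)) ∈ C) (n : ℕ) :
    {w : List A | w.length = n ∧ InLanguage (closure C) w}.ncard =
      ((fun (x : ℤ → A) (i : Fin n) => x (i : ℕ)) '' C).ncard := by
  rw [← Set.ncard_image_of_injective _ (List.ofFn_injective (n := n)), Set.image_image]
  congr 1
  ext w
  simp only [Set.mem_ofPred_eq, inLanguage_closure_iff_s15 hC, Set.mem_image]
  constructor
  · rintro ⟨rfl, x, hx, h⟩
    refine ⟨x, hx, List.ext_getElem (by simp) fun i hi hi' => ?_⟩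
    simpa using h i hi'
  · rintro ⟨x, hx, rfl⟩
    exact ⟨by simp, x, hx, fun i hi => by simp⟩

/-- The length, capped at `n`, of the longest initial segment of `ℕ` on which `P` holds. -/
noncomputable def initialLength (n : ℕ) (P : ℕ → Prop) : ℕ := sInf {k | n ≤ k ∨ ¬ P k}

theorem initialLength_le (n : ℕ) (P : ℕ → Prop) : initialLength n P ≤ n :=
  Nat.sInf_le (Or.inl le_rfl)

theorem lt_initialLength_iff {n : ℕ} {P : ℕ → Prop} {k : ℕ} :
    k < initialLength n P ↔ k < n ∧ ∀ j ≤ k, P j := by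
  constructor
  · refine fun h => ⟨h.trans_le (initialLength_le n P), fun j hj => ?_⟩
    have := Nat.notMem_of_lt_sInf (hj.trans_lt h)
    by_contra hP
    exact this (Or.inr hP)
  · rintro ⟨hn, h⟩
    by_contra hlt
    rcases Nat.sInf_mem (s := {k | n ≤ k ∨ ¬ P k}) ⟨n, Or.inl le_rfl⟩ with h' | h'
    · exact absurd (h'.trans (not_lt.1 hlt)) (by omega)
    · exact h' (h _ (not_lt.1 hlt))

theorem eq_inl_of_eq_inl {V : Type*} {Adj : V → V → Prop} {v : V} (hLoop : ∀ u, ¬ Adj u u)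
    {x : ℤ → V ⊕ Unit} (hA : ∀ k, x k ≠ x (k + 1) → extAdj Adj v (x k) (x (k + 1))) {a b : ℤ}
    (hab : a ≤ b) (hv : ∀ k, a ≤ k → k ≤ b → collapse v (x k) = v) (hb : x b = Sum.inl v) :
    x a = Sum.inl v := by
  induction b, hab using Int.leInduction with
  | base => exact hb
  | succ b hab ih =>
    refine ih (fun k h h' => hv k h (by omega)) ?_
    refine (collapse_eq_self_iff.1 (hv b hab (by omega))).resolve_right fun h => ?_
    have := hA b
    rw [h, hb] at this
    exact hLoop v (this (by simp))

theorem eqOn_of_initialLength_eq {V : Type*} [DecidableEq V] {Adj : V → V → Prop}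
    {S : V → Set ℕ} {v : V} {T₁ T₂ : Set ℕ} (hLoop : ∀ u, ¬ Adj u u)
    (huniq : ∀ t₁ ∈ T₁, ∀ t₂ ∈ T₂, ∀ t₁' ∈ T₁, ∀ t₂' ∈ T₂,
      t₁ + t₂ = t₁' + t₂' → t₁ = t₁' ∧ t₂ = t₂') {x y : ℤ → V ⊕ Unit}
    (hx : RunsAdmissible (extAdj Adj v) (extS S v T₁ T₂) x)
    (hy : RunsAdmissible (extAdj Adj v) (extS S v T₁ T₂) y)
    (hxf : FiniteRuns (collapse v ∘ x)) {n : ℕ}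
    (heq : ∀ k : ℕ, k < n → collapse v (x k) = collapse v (y k))
    (hinl : initialLength n (fun k => x k = Sum.inl v) =
      initialLength n fun k => y k = Sum.inl v)
    (hinr : initialLength n (fun k => x (n - 1 - k) = Sum.inr ()) =
      initialLength n fun k => y (n - 1 - k) = Sum.inr ()) (k : ℕ) (hk : k < n) :
    x k = y k := by
  have heq' : ∀ j : ℤ, 0 ≤ j → j < n → collapse v (x j) = collapse v (y j) := fun j h h' => by
    lift j to ℕ using h
    exact heq j (by omega)
  have eq_of_iff : ∀ j, collapse v (x j) = v → collapse v (y j) = v →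
      (x j = Sum.inl v ↔ y j = Sum.inl v) → x j = y j := fun j h h' => by
    rw [collapse_eq_self_iff] at h h'
    rcases h with h | h <;> rcases h' with h' | h' <;> simp [h, h']
  by_cases hleft : ∀ p : ℤ, 0 ≤ p → p ≤ k → collapse v (x p) = v
  · have key : ∀ z : ℤ → V ⊕ Unit, RunsAdmissible (extAdj Adj v) (extS S v T₁ T₂) z →
        (∀ p : ℤ, 0 ≤ p → p ≤ k → collapse v (z p) = v) →
        (z k = Sum.inl v ↔ k < initialLength n fun k => z k = Sum.inl v) := fun z hz hzv => by
      rw [lt_initialLength_iff]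
      refine ⟨fun h => ⟨hk, fun j hj => ?_⟩, fun h => h.2 k le_rfl⟩
      exact eq_inl_of_eq_inl hLoop hz.1 (b := k) (by omega)
        (fun p hp hp' => hzv p (by omega) hp') h
    have hyv : ∀ p : ℤ, 0 ≤ p → p ≤ k → collapse v (y p) = v := fun p hp hp' => by
      rw [← heq' p hp (by omega)]
      exact hleft p hp hp'
    refine eq_of_iff k (hleft k (by omega) le_rfl) (hyv k (by omega) le_rfl) ?_
    rw [key x hx hleft, key y hy hyv, hinl]
  by_cases hright : ∀ q : ℤ, k ≤ q → q < n → collapse v (x q) = v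
  · have key : ∀ z : ℤ → V ⊕ Unit, RunsAdmissible (extAdj Adj v) (extS S v T₁ T₂) z →
        (∀ q : ℤ, k ≤ q → q < n → collapse v (z q) = v) →
        (z k = Sum.inl v ↔
          ¬ n - 1 - k < initialLength n fun k => z (n - 1 - k) = Sum.inr ()) :=
        fun z hz hzv => by
      rw [lt_initialLength_iff]
      constructor
      · rintro h ⟨-, h'⟩
        have := h' _ le_rfl
        rw [show (n : ℤ) - 1 - (n - 1 - k : ℕ) = k by omega, h] at this
        cases this
      · intro h
        refine (collapse_eq_self_iff.1 (hzv k le_rfl (by omega))).resolve_right fun h' => ?_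
        refine h ⟨by omega, fun j hj => ?_⟩
        refine (collapse_eq_self_iff.1 (hzv _ (by omega) (by omega))).resolve_left fun h'' => ?_
        have := eq_inl_of_eq_inl hLoop hz.1 (a := k) (by omega)
          (fun q hq hq' => hzv q hq (by omega)) h''
        rw [h'] at this
        cases this
    have hyv : ∀ q : ℤ, k ≤ q → q < n → collapse v (y q) = v := fun q hq hq' => by
      rw [← heq' q (by omega) hq']
      exact hright q hq hq'
    refine eq_of_iff k (hright k le_rfl (by omega)) (hyv k le_rfl (by omega)) ?_
    rw [key x hx hright, key y hy hyv, hinr]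
  push Not at hleft hright
  obtain ⟨p, hp, hpk, hpv⟩ := hleft
  obtain ⟨q, hkq, hq, hqv⟩ := hright
  exact eqOn_of_collapse_eqOn hLoop huniq hx hy hxf
    (fun j h h' => heq' j (by omega) (by omega)) hpv hqv k hpk hkq

theorem tendsto_log_div_iff_of_le_of_le {a b : ℕ → ℕ} (hab : ∀ n, a n ≤ b n)
    (hba : ∀ n, b n ≤ a n * (n + 1) ^ 2) (h : ℝ) :
    Tendsto (fun n => Real.log (a n) / n) atTop (𝓝 h) ↔
      Tendsto (fun n => Real.log (b n) / n) atTop (𝓝 h) := by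
  have hlog : ∀ n, Real.log (a n) ≤ Real.log (b n) ∧
      Real.log (b n) - Real.log (a n) ≤ 2 * Real.log (n + 1) := fun n => by
    have hn : 0 ≤ Real.log ((n : ℝ) + 1) := Real.log_nonneg (by simp)
    rcases Nat.eq_zero_or_pos (a n) with ha | ha
    · have hb : b n = 0 := by simpa [ha] using hba n
      simpa [ha, hb] using hn
    · have ha' : (0 : ℝ) < a n := by exact_mod_cast ha
      have hb' : (0 : ℝ) < b n := by exact_mod_cast ha.trans_le (hab n)
      refine ⟨Real.log_le_log ha' (by exact_mod_cast hab n), ?_⟩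
      have h1 : Real.log (b n) ≤ Real.log (a n * ((n : ℝ) + 1) ^ 2) :=
        Real.log_le_log hb' (by exact_mod_cast hba n)
      rw [Real.log_mul ha'.ne' (by positivity), Real.log_pow] at h1
      push_cast at h1
      linarith
  have hdiff : Tendsto (fun n : ℕ => Real.log (b n) / n - Real.log (a n) / n) atTop (𝓝 0) := by
    have h0 : Tendsto (fun n : ℕ => 4 * (Real.log ((n : ℝ) + 1) / ((n : ℝ) + 1))) atTop (𝓝 0) := by
      have := Real.isLittleO_log_id_atTop.tendsto_div_nhds_zero.comp
        (tendsto_atTop_add_const_right atTop (1 : ℝ) (tendsto_natCast_atTop_atTop (R := ℝ)))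
      simpa using this.const_mul 4
    refine tendsto_of_tendsto_of_tendsto_of_le_of_le' tendsto_const_nhds h0
      (Eventually.of_forall fun n => ?_) ((eventually_ge_atTop 1).mono fun n hn => ?_)
    · rw [← sub_div]
      exact div_nonneg (sub_nonneg.2 (hlog n).1) n.cast_nonneg
    · have hn' : (1 : ℝ) ≤ n := by exact_mod_cast hn
      have hl : 0 ≤ Real.log ((n : ℝ) + 1) := Real.log_nonneg (by simp)
      rw [← sub_div, ← mul_div_assoc, div_le_div_iff₀ (by positivity) (by positivity)]
      nlinarith [mul_le_mul_of_nonneg_right (hlog n).2 (by positivity : (0 : ℝ) ≤ n + 1),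
        mul_nonneg hl (sub_nonneg.2 hn')]
  constructor
  · intro ha
    simpa using ha.add hdiff
  · intro hb
    simpa using hb.sub hdiff

theorem ncard_image_le_ncard_image_mul {X α β : Type*} [Finite β] {C : Set X} {n : ℕ}
    {f : X → α} {g : X → β} {i j : X → ℕ} (hi : ∀ x, i x ≤ n) (hj : ∀ x, j x ≤ n)
    (hinj : ∀ x ∈ C, ∀ y ∈ C, g x = g y → i x = i y → j x = j y → f x = f y) :
    (f '' C).ncard ≤ (g '' C).ncard * (n + 1) ^ 2 := by
  have hcard : ((g '' C) ×ˢ ((Finset.range (n + 1) ×ˢ Finset.range (n + 1) : Finset (ℕ × ℕ)) :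
      Set (ℕ × ℕ))).ncard = (g '' C).ncard * (n + 1) ^ 2 := by
    rw [Set.ncard_prod, Set.ncard_coe_finset, Finset.card_product, Finset.card_range, sq]
  obtain ⟨D, hDC, hD⟩ := Set.exists_subset_bijOn C f
  rw [← hcard, ← hD.image_eq, hD.injOn.ncard_image]
  refine Set.ncard_le_ncard_of_injOn (fun x => (g x, i x, j x)) (fun x hx => ?_)
    (fun x hx y hy h => ?_) ((Set.toFinite _).prod (Finset.finite_toSet _))
  · have h1 := hi x
    have h2 := hj x
    exact ⟨⟨x, hDC hx, rfl⟩, by simp; omega⟩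
  · simp only [Prod.mk.injEq] at h
    exact hD.injOn hx hy (hinj x (hDC hx) y (hDC hy) h.1 h.2.1 h.2.2)

theorem FiniteRuns.exists_ne_below_above {A : Type*} {x : ℤ → A} (hx : FiniteRuns x) (v : A)
    (m : ℤ) : (∃ p ≤ m, x p ≠ v) ∧ ∃ q ≥ m, x q ≠ v := by
  obtain ⟨a, b, ha, hb, hr⟩ := hx m
  by_cases h : x m = v
  · rw [h] at hr
    exact ⟨⟨a - 1, by omega, hr.2.2.1⟩, b, by omega, hr.2.2.2⟩
  · exact ⟨⟨m, le_rfl, h⟩, m, le_rfl, h⟩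

/-- **Edge extension preserves entropy and mixing.**  Let `(G,S)` be a
set-equipped graph, `v` a vertex, and `S_v = T₁ ⊕ T₂` a sum decomposition
(every element of `S_v` is uniquely a sum `t₁ + t₂`, `t₁ ∈ T₁`, `t₂ ∈ T₂`).
Then `X(G,S)` and the edge-extended shift `X(G',S')` have the same topological
entropy, and one is mixing iff the other is. -/
theorem edgeExtension_entropy_mixing {V : Type*} [Fintype V] [DecidableEq V]
    [TopologicalSpace V] [DiscreteTopology V]
    (Adj : V → V → Prop) (S : V → Set ℕ) (v : V)
    (hLoop : ∀ u, ¬ Adj u u)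
    (hNe : ∀ u, (S u).Nonempty) (hPos : ∀ u, 0 ∉ S u)
    (T₁ T₂ : Set ℕ) (hT₁ : T₁.Nonempty) (hT₂ : T₂.Nonempty)
    (hT₁0 : 0 ∉ T₁) (hT₂0 : 0 ∉ T₂)
    (hsum : ∀ s, s ∈ S v ↔ ∃ t₁ ∈ T₁, ∃ t₂ ∈ T₂, s = t₁ + t₂)
    (huniq : ∀ t₁ ∈ T₁, ∀ t₂ ∈ T₂, ∀ t₁' ∈ T₁, ∀ t₂' ∈ T₂,
      t₁ + t₂ = t₁' + t₂' → t₁ = t₁' ∧ t₂ = t₂') :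
    (∀ h : ℝ, HasEntropy (closure (SGraphCore Adj S)) h ↔
      HasEntropy (closure (SGraphCore (extAdj Adj v) (extS S v T₁ T₂))) h) ∧
    (IsMixing (closure (SGraphCore Adj S)) ↔
      IsMixing (closure (SGraphCore (extAdj Adj v) (extS S v T₁ T₂)))) := by
  have hmem {x} := mem_sGraphCore_iff_runsAdmissible (Adj := Adj) (S := S) (x := x) hLoop
  have hmem' {x} := mem_sGraphCore_iff_runsAdmissible (Adj := extAdj Adj v)
    (S := extS S v T₁ T₂) (x := x) (extAdj_loopless v hLoop)
  have hshift := fun x (hx : x ∈ SGraphCore Adj S) => sGraphCore_shift hx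
  have hshift' := fun x (hx : x ∈ SGraphCore (extAdj Adj v) (extS S v T₁ T₂)) =>
    sGraphCore_shift hx
  have himage : (fun x => collapse v ∘ x) '' SGraphCore (extAdj Adj v) (extS S v T₁ T₂) =
      SGraphCore Adj S := by
    ext x
    constructor
    · rintro ⟨y, hy, rfl⟩
      exact hmem.2 ((hmem'.1 hy).collapse_comp hLoop hsum)
    · intro hx
      obtain ⟨y, hy, rfl⟩ := exists_runsAdmissible_lift hT₁0 hT₂0 hsum huniq (hmem.1 hx)
      exact ⟨y, hmem'.2 hy, rfl⟩
  have hproj : ∀ x ∈ SGraphCore (extAdj Adj v) (extS S v T₁ T₂),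
      collapse v ∘ x ∈ SGraphCore Adj S := fun x hx => himage ▸ Set.mem_image_of_mem _ hx
  refine ⟨fun h => ?_, ?_⟩
  · simp only [HasEntropy, ncard_inLanguage_closure hshift, ncard_inLanguage_closure hshift']
    refine tendsto_log_div_iff_of_le_of_le (fun n => ?_) (fun n => ?_) h
    · rw [← himage, Set.image_image]
      have := Set.ncard_image_le (f := fun w : Fin n → V ⊕ Unit => collapse v ∘ w)
        (Set.toFinite ((fun (x : ℤ → V ⊕ Unit) (i : Fin n) => x (i : ℕ)) ''
          SGraphCore (extAdj Adj v) (extS S v T₁ T₂)))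
      rwa [Set.image_image] at this
    · rw [← himage, Set.image_image]
      refine ncard_image_le_ncard_image_mul
        (i := fun x => initialLength n fun k => x k = Sum.inl v)
        (j := fun x => initialLength n fun k => x (n - 1 - k) = Sum.inr ())
        (fun x => initialLength_le _ _) (fun x => initialLength_le _ _) ?_
      intro x hx y hy hxy hi hj
      funext k
      exact eqOn_of_initialLength_eq hLoop huniq (hmem'.1 hx) (hmem'.1 hy)
        (hmem.1 (hproj x hx)).2.2 (fun k hk => congrFun hxy ⟨k, hk⟩) hi hj k k.2
  · rw [isMixing_closure_iff hshift, isMixing_closure_iff hshift']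
    constructor
    · intro hmix x hx y hy M
      have hxf := (hmem.1 (hproj x hx)).2.2
      have hyf := (hmem.1 (hproj y hy)).2.2
      obtain ⟨p, hp, hpv⟩ := (hxf.exists_ne_below_above v (-M)).1
      obtain ⟨q, hq, hqv⟩ := (hxf.exists_ne_below_above v M).2
      obtain ⟨p', hp', hpv'⟩ := (hyf.exists_ne_below_above v (-M)).1
      obtain ⟨q', hq', hqv'⟩ := (hyf.exists_ne_below_above v M).2
      obtain ⟨N, hN⟩ := hmix _ (hproj x hx) _ (hproj y hy)
        (p.natAbs + q.natAbs + p'.natAbs + q'.natAbs)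
      have hbound : ∀ {i}, (p ≤ i ∧ i ≤ q) ∨ (p' ≤ i ∧ i ≤ q') →
          -(p.natAbs + q.natAbs + p'.natAbs + q'.natAbs) ≤ i ∧
            i ≤ p.natAbs + q.natAbs + p'.natAbs + q'.natAbs := by
        intro i
        omega
      refine ⟨N, fun l hl => ?_⟩
      obtain ⟨z, hz, hzx, hzy⟩ := hN l hl
      rw [← himage] at hz
      obtain ⟨z, hz, rfl⟩ := hz
      refine ⟨z, hz, fun i hi hi' => ?_, fun i hi hi' => ?_⟩
      · refine (eqOn_of_collapse_eqOn hLoop huniq (hmem'.1 hx) (hmem'.1 hz) hxf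
          (fun k hk hk' => ?_) hpv hqv i (by omega) (by omega)).symm
        have := hbound (Or.inl ⟨hk, hk'⟩)
        exact (hzx k this.1 this.2).symm
      · have := eqOn_of_collapse_eqOn hLoop huniq (hmem'.1 hy) (hmem'.1 (hshift' z hz l)) hyf
          (fun k hk hk' => ?_) hpv' hqv' i (by omega) (by omega)
        · rw [this, add_comm]
        · have := hbound (Or.inr ⟨hk, hk'⟩)
          rw [add_comm]
          exact (hzy k this.1 this.2).symm
    · intro hmix x hx y hy M
      rw [← himage] at hx hy
      obtain ⟨x, hx, rfl⟩ := hx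
      obtain ⟨y, hy, rfl⟩ := hy
      obtain ⟨N, hN⟩ := hmix x hx y hy M
      refine ⟨N, fun l hl => ?_⟩
      obtain ⟨z, hz, hzx, hzy⟩ := hN l hl
      exact ⟨_, hproj z hz, fun i h h' => congrArg _ (hzx i h h'),
        fun i h h' => congrArg _ (hzy i h h')⟩
end
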